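/- If p: B → G is a separable Fell bundle over a second countable locally compact Hausdorff groupoid G and A := Γ₀(G⁰; B) is the associated C*-algebra over G⁰, then the G-action on Prim A defined by x·(s(x),P) := (r(x), h_x(P)) is continuous, i.e., the map (x, (s(x),P)) ↦ (r(x), h_x(P)) from G * Prim A = {(x, (u,P)) : u = s(x)} to Prim A is continuous when Prim A carries the hull-kernel topology; thus Prim A is a topological G-space. -/

import Mathlib

noncomputable section

open Filter
open scoped Topology

/-- A locally compact Hausdorff groupoid, encoded "flatly": the partially defined
multiplication `gmul` is a total function whose value is only meaningful (and only
constrained by the axioms) on composable pairs, i.e. pairs `(x, y)` with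
`src x = rng y`. -/
structure LCGroupoid where
  /-- the underlying space of the groupoid -/
  G : Type
  [topG : TopologicalSpace G]
  t2G : T2Space G
  lcG : LocallyCompactSpace G
  /-- the source map (with values in the unit space) -/
  src : G → G
  /-- the range map (with values in the unit space) -/
  rng : G → G
  /-- the partial multiplication (junk value unless `src x = rng y`) -/
  gmul : G → G → G
  /-- inversion -/
  ginv : G → G
  src_rng : ∀ x, src (rng x) = rng x
  rng_rng : ∀ x, rng (rng x) = rng x
  src_src : ∀ x, src (src x) = src x
  rng_src : ∀ x, rng (src x) = src x
  rng_gmul : ∀ x y, src x = rng y → rng (gmul x y) = rng x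
  src_gmul : ∀ x y, src x = rng y → src (gmul x y) = src y
  gmul_assoc : ∀ x y z, src x = rng y → src y = rng z →
    gmul (gmul x y) z = gmul x (gmul y z)
  gmul_rng : ∀ x, gmul (rng x) x = x
  gmul_src : ∀ x, gmul x (src x) = x
  src_ginv : ∀ x, src (ginv x) = rng x
  rng_ginv : ∀ x, rng (ginv x) = src x
  ginv_ginv : ∀ x, ginv (ginv x) = x
  gmul_ginv : ∀ x, gmul x (ginv x) = rng x
  ginv_gmul : ∀ x, gmul (ginv x) x = src x
  ginv_gmul_eq : ∀ x y, src x = rng y → ginv (gmul x y) = gmul (ginv y) (ginv x)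
  ginv_unit : ∀ u, rng u = u → ginv u = u
  cont_ginv : Continuous ginv
  cont_gmul : Continuous (fun q : {q : G × G // src q.1 = rng q.2} => gmul q.1.1 q.1.2)

attribute [instance] LCGroupoid.topG

/-- The unit space `G⁰` of the groupoid, i.e. the set of units, with its subspace
topology. -/
def LCGroupoid.UnitSpace (Γ : LCGroupoid) : Type := {u : Γ.G // Γ.rng u = u}

instance (Γ : LCGroupoid) : TopologicalSpace Γ.UnitSpace :=
  instTopologicalSpaceSubtype

/-- The data and most axioms of a Fell bundle `p : B → G` over a locally compact
Hausdorff groupoid, again encoded "flatly": the total space is `T`, the fibre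
`B(x)` is `{b : T | p b = x}`, the fibrewise algebraic operations are total
functions which are constrained by the axioms only on the appropriate domains
(e.g. `badd` on pairs in a common fibre, `bmul` on pairs whose base points are
composable).  The axioms say: each fibre is a complex Banach space (whose
topology is the subspace topology); the norm is upper semicontinuous and the
bundle operations are continuous; `bmul`/`bstar` are a continuous bilinear
associative multiplication and involution covering the groupoid operations;
each unit fibre `B(u)` is a C*-algebra (C*-identity, submultiplicativity,
positivity of `b* b`). Saturation is added in `FellBundle` below. -/
structure FellBundleData extends LCGroupoid where
  /-- the total space of the bundle -/
  T : Type
  [topT : TopologicalSpace T]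
  /-- the bundle projection -/
  p : T → G
  /-- the fibrewise norm -/
  bnorm : T → ℝ
  /-- fibrewise addition (junk unless both arguments lie in a common fibre) -/
  badd : T → T → T
  /-- fibrewise scalar multiplication -/
  bsmul : ℂ → T → T
  /-- the zero section -/
  bzero : G → T
  /-- the Fell bundle multiplication (junk unless `src (p a) = rng (p b)`) -/
  bmul : T → T → T
  /-- the Fell bundle involution -/
  bstar : T → T
  p_cont : Continuous p
  p_open : IsOpenMap p
  p_badd : ∀ a b, p a = p b → p (badd a b) = p a
  p_bsmul : ∀ c a, p (bsmul c a) = p a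
  p_bzero : ∀ x, p (bzero x) = x
  p_bmul : ∀ a b, src (p a) = rng (p b) → p (bmul a b) = gmul (p a) (p b)
  p_bstar : ∀ a, p (bstar a) = ginv (p a)
  badd_comm : ∀ a b, p a = p b → badd a b = badd b a
  badd_assoc : ∀ a b c, p a = p b → p b = p c → badd (badd a b) c = badd a (badd b c)
  bzero_badd : ∀ a, badd (bzero (p a)) a = a
  badd_neg : ∀ a, badd a (bsmul (-1) a) = bzero (p a)
  one_bsmul : ∀ a, bsmul 1 a = a
  mul_bsmul : ∀ c d a, bsmul (c * d) a = bsmul c (bsmul d a)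
  add_bsmul : ∀ c d a, bsmul (c + d) a = badd (bsmul c a) (bsmul d a)
  bsmul_badd : ∀ c a b, p a = p b → bsmul c (badd a b) = badd (bsmul c a) (bsmul c b)
  zero_bsmul : ∀ a, bsmul 0 a = bzero (p a)
  bsmul_bzero : ∀ c x, bsmul c (bzero x) = bzero x
  bnorm_nonneg : ∀ a, 0 ≤ bnorm a
  bnorm_badd_le : ∀ a b, p a = p b → bnorm (badd a b) ≤ bnorm a + bnorm b
  bnorm_bsmul : ∀ c a, bnorm (bsmul c a) = ‖c‖ * bnorm a
  bnorm_eq_zero : ∀ a, bnorm a = 0 ↔ a = bzero (p a)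
  /-- each fibre is complete -/
  fiber_complete : ∀ x (f : ℕ → T), (∀ n, p (f n) = x) →
    (∀ ε : ℝ, 0 < ε → ∃ N, ∀ m n, N ≤ m → N ≤ n →
      bnorm (badd (f m) (bsmul (-1) (f n))) < ε) →
    ∃ L, p L = x ∧
      Tendsto (fun n => bnorm (badd (f n) (bsmul (-1) L))) atTop (nhds 0)
  cont_badd : Continuous (fun q : {q : T × T // p q.1 = p q.2} => badd q.1.1 q.1.2)
  cont_bsmul : Continuous (fun q : ℂ × T => bsmul q.1 q.2)
  cont_bzero : Continuous bzero
  usc_bnorm : UpperSemicontinuous bnorm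
  /-- on each fibre, the subspace topology is finer than the norm topology -/
  fiber_nbhd_norm : ∀ b, ∀ ε : ℝ, 0 < ε →
    ∃ U ∈ nhds b, ∀ c ∈ U, p c = p b → bnorm (badd c (bsmul (-1) b)) < ε
  /-- on each fibre, the norm topology is finer than the subspace topology -/
  norm_nbhd_fiber : ∀ b, ∀ U ∈ nhds b, ∃ ε : ℝ, 0 < ε ∧
    ∀ c, p c = p b → bnorm (badd c (bsmul (-1) b)) < ε → c ∈ U
  /-- if `‖b_i‖ → 0` and `p (b_i) → x` then `b_i → 0_x` -/
  zero_nbhd : ∀ x, ∀ U ∈ nhds (bzero x), ∃ V ∈ nhds x, ∃ ε : ℝ, 0 < ε ∧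
    ∀ b, p b ∈ V → bnorm b < ε → b ∈ U
  bmul_assoc : ∀ a b c, src (p a) = rng (p b) → src (p b) = rng (p c) →
    bmul (bmul a b) c = bmul a (bmul b c)
  bmul_badd : ∀ a a' b, p a = p a' → src (p a) = rng (p b) →
    bmul (badd a a') b = badd (bmul a b) (bmul a' b)
  badd_bmul : ∀ a b b', p b = p b' → src (p a) = rng (p b) →
    bmul a (badd b b') = badd (bmul a b) (bmul a b')
  bsmul_bmul : ∀ (c : ℂ) a b, src (p a) = rng (p b) →
    bmul (bsmul c a) b = bsmul c (bmul a b)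
  bmul_bsmul : ∀ (c : ℂ) a b, src (p a) = rng (p b) →
    bmul a (bsmul c b) = bsmul c (bmul a b)
  cont_bmul :
    Continuous (fun q : {q : T × T // src (p q.1) = rng (p q.2)} => bmul q.1.1 q.1.2)
  bstar_bstar : ∀ a, bstar (bstar a) = a
  bstar_badd : ∀ a b, p a = p b → bstar (badd a b) = badd (bstar a) (bstar b)
  bstar_bsmul : ∀ c a, bstar (bsmul c a) = bsmul (starRingEnd ℂ c) (bstar a)
  bstar_bmul : ∀ a b, src (p a) = rng (p b) →
    bstar (bmul a b) = bmul (bstar b) (bstar a)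
  cont_bstar : Continuous bstar
  /-- the C*-identity `‖b* b‖ = ‖b‖ ^ 2` (this holds in every fibre since `B(x)` is
  an imprimitivity bimodule with inner products `⟨a, b⟩ = a* b` and `a b*`) -/
  cstar_identity : ∀ a, bnorm (bmul (bstar a) a) = bnorm a ^ 2
  /-- the norm on each unit fibre (a C*-algebra) is submultiplicative -/
  unit_submul : ∀ a b, p a = p b → rng (p a) = p a →
    bnorm (bmul a b) ≤ bnorm a * bnorm b
  /-- `b* b ≥ 0` in the C*-algebra `B(s(b))`: positivity in a C*-algebra is
  encoded as being of the form `c* c` -/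
  bmul_pos : ∀ a, ∃ c, p c = src (p a) ∧ bmul (bstar a) a = bmul (bstar c) c

attribute [instance] FellBundleData.topT

namespace FellBundleData

variable (Ω : FellBundleData)

/-- The fibre `B(x)` of the bundle over `x`, as a subset of the total space. -/
def fiberSet (x : Ω.G) : Set Ω.T := {b | Ω.p b = x}

/-- Finite sums of elements of `S`, computed in the fibre over `x`. -/
def finSums (x : Ω.G) (S : Set Ω.T) : Set Ω.T :=
  {t | ∃ l : List Ω.T, (∀ a ∈ l, a ∈ S) ∧ t = l.foldr Ω.badd (Ω.bzero x)}

/-- The linear span of `S` inside the fibre over `x`. -/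
def spanIn (x : Ω.G) (S : Set Ω.T) : Set Ω.T :=
  Ω.finSums x {t | ∃ c s, s ∈ S ∧ t = Ω.bsmul c s}

/-- The closed linear span of `S` inside the fibre over `x`. -/
def closedSpan (x : Ω.G) (S : Set Ω.T) : Set Ω.T := closure (Ω.spanIn x S)

end FellBundleData

/-- A (saturated) Fell bundle over a locally compact Hausdorff groupoid. -/
structure FellBundle extends FellBundleData where
  /-- saturation: `B(x) B(y)` spans a dense subspace of `B(xy)` -/
  saturated : ∀ x y, src x = rng y →
    toFellBundleData.closedSpan (gmul x y)
        {t | ∃ a b, p a = x ∧ p b = y ∧ t = bmul a b} =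
      toFellBundleData.fiberSet (gmul x y)

namespace FellBundleData

variable (Ω : FellBundleData)

/-- `Ω.IsA σ` says that `σ` is an element of the C*-algebra `A = Γ₀(G⁰; B)` of the
Fell bundle sitting over the unit space: a continuous section over `G⁰` vanishing
at infinity. -/
def IsA (σ : Ω.toLCGroupoid.UnitSpace → Ω.T) : Prop :=
  (∀ u, Ω.p (σ u) = u.1) ∧ Continuous σ ∧
    ∀ ε : ℝ, 0 < ε →
      ∃ K : Set Ω.toLCGroupoid.UnitSpace, IsCompact K ∧ ∀ u ∉ K, Ω.bnorm (σ u) < ε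

/-- `Ω.IsIdealA J` says that `J` is a (closed, two-sided) ideal in the C*-algebra
`A = Γ₀(G⁰; B)`. -/
def IsIdealA (J : Set (Ω.toLCGroupoid.UnitSpace → Ω.T)) : Prop :=
  (∀ σ ∈ J, Ω.IsA σ) ∧
  ((fun u => Ω.bzero u.1) ∈ J) ∧
  (∀ σ ∈ J, ∀ τ ∈ J, (fun u => Ω.badd (σ u) (τ u)) ∈ J) ∧
  (∀ c : ℂ, ∀ σ ∈ J, (fun u => Ω.bsmul c (σ u)) ∈ J) ∧
  (∀ σ ∈ J, ∀ τ, Ω.IsA τ →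
    (fun u => Ω.bmul (σ u) (τ u)) ∈ J ∧ (fun u => Ω.bmul (τ u) (σ u)) ∈ J) ∧
  (∀ σ, Ω.IsA σ →
    (∀ ε : ℝ, 0 < ε → ∃ τ ∈ J, ∀ u, Ω.bnorm (Ω.badd (σ u) (Ω.bsmul (-1) (τ u))) < ε) →
    σ ∈ J)

/-- The image `q_u(J) = J(u) ⊆ B(u) = A(u)` of a subset `J ⊆ A` in the fibre over
the unit `u`. -/
def fiberIm (J : Set (Ω.toLCGroupoid.UnitSpace → Ω.T)) (u : Ω.G) : Set Ω.T :=
  {t | ∃ σ ∈ J, ∃ h : Ω.rng u = u, t = σ ⟨u, h⟩}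

/-- A representation of the C*-algebra `B(u)` (`u` a unit) on a Hilbert space `H`:
a `*`-homomorphism `π` on the fibre over `u`, automatically norm-decreasing. -/
def IsFiberRep (u : Ω.G) {H : Type} [NormedAddCommGroup H] [InnerProductSpace ℂ H]
    [CompleteSpace H] (π : Ω.T → H →L[ℂ] H) : Prop :=
  (∀ a b, Ω.p a = u → Ω.p b = u → π (Ω.badd a b) = π a + π b) ∧
  (∀ (c : ℂ) a, Ω.p a = u → π (Ω.bsmul c a) = c • π a) ∧
  (∀ a b, Ω.p a = u → Ω.p b = u → π (Ω.bmul a b) = (π a).comp (π b)) ∧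
  (∀ a, Ω.p a = u → π (Ω.bstar a) = ContinuousLinearMap.adjoint (π a)) ∧
  (∀ a, Ω.p a = u → ‖π a‖ ≤ Ω.bnorm a)

/-- An irreducible representation of the C*-algebra `B(u)`: nonzero, and with no
nontrivial closed invariant subspace. -/
def IsIrredFiberRep (u : Ω.G) {H : Type} [NormedAddCommGroup H]
    [InnerProductSpace ℂ H] [CompleteSpace H] (π : Ω.T → H →L[ℂ] H) : Prop :=
  Ω.IsFiberRep u π ∧ (∃ a, Ω.p a = u ∧ π a ≠ 0) ∧
  (∀ K : Submodule ℂ H, IsClosed (K : Set H) →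
    (∀ a, Ω.p a = u → ∀ v ∈ K, π a v ∈ K) → K = ⊥ ∨ K = ⊤)

/-- The primitive ideal space `Prim A(u)` of the C*-algebra `A(u) = B(u)` over a
unit `u`: the set of kernels of irreducible representations of `B(u)`, viewed as
subsets of the fibre over `u`. -/
def PrimFiber (u : Ω.G) : Set (Set Ω.T) :=
  {P | Ω.rng u = u ∧
    ∃ (H : Type) (iN : NormedAddCommGroup H) (iP : InnerProductSpace ℂ H)
      (iC : CompleteSpace H) (π : Ω.T → H →L[ℂ] H),
      Ω.IsIrredFiberRep u π ∧ P = {a | Ω.p a = u ∧ π a = 0}}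

/-- The Rieffel correspondence `h_x` on ideals, induced by the
`A(r(x)) – A(s(x))`-imprimitivity bimodule `B(x)`: an ideal `J ⊆ A(s(x))` is sent
to the induced ideal `⟨B(x)·J, B(x)⟩_{A(r(x))} = span{(a d) b* : a, b ∈ B(x), d ∈ J}`
(closed span) in `A(r(x))`. -/
def hIdeal (x : Ω.G) (J : Set Ω.T) : Set Ω.T :=
  Ω.closedSpan (Ω.rng x)
    {t | ∃ a b d, Ω.p a = x ∧ Ω.p b = x ∧ d ∈ J ∧ t = Ω.bmul (Ω.bmul a d) (Ω.bstar b)}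

/-- `I ⊆ A` is a `G`-invariant ideal: it is an ideal, and its hull
`{(u, P) : I(u) ⊆ P} ⊆ Prim A` is invariant under the `G`-action
`x · (s(x), P) = (r(x), h_x(P))`. -/
def GInvariant (I : Set (Ω.toLCGroupoid.UnitSpace → Ω.T)) : Prop :=
  Ω.IsIdealA I ∧
  ∀ x (P : Set Ω.T), P ∈ Ω.PrimFiber (Ω.src x) →
    Ω.fiberIm I (Ω.src x) ⊆ P → Ω.fiberIm I (Ω.rng x) ⊆ Ω.hIdeal x P

/-- The subset `B_I = {b ∈ B : b* b ∈ I(s(b))}` of the total space associated to an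
ideal `I ⊆ A`. -/
def BIset (I : Set (Ω.toLCGroupoid.UnitSpace → Ω.T)) : Set Ω.T :=
  {b | Ω.bmul (Ω.bstar b) b ∈ Ω.fiberIm I (Ω.src (Ω.p b))}

end FellBundleData
namespace FellBundleData

variable (Ω : FellBundleData)

/-- `Prim A` for `A = Γ₀(G⁰; B)`, identified with the disjoint union of the
`Prim A(u)`: pairs `(u, P)` with `u ∈ G⁰` and `P ∈ Prim A(u)`. -/
def PrimPair : Type := {q : Ω.G × Set Ω.T // q.2 ∈ Ω.PrimFiber q.1}

/-- The hull-kernel topology on `Prim A = {(u, P)}`, transported through the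
identification `(u, P) = q_u⁻¹(P)`: the open sets are generated by the sets
`O_J = {(u, P) : (u, P) ⊉ J} = {(u, P) : q_u(J) ⊄ P}` for ideals `J` of `A`. -/
def hullKernelTop : TopologicalSpace Ω.PrimPair :=
  TopologicalSpace.generateFrom
    {U | ∃ J, Ω.IsIdealA J ∧ U = {P : Ω.PrimPair | ¬ Ω.fiberIm J P.1.1 ⊆ P.1.2}}

/-- A continuous section of the bundle over all of `G`, vanishing at infinity:
an element of the Banach space `Γ₀(G; B)`. -/
def IsSecG (σ : Ω.G → Ω.T) : Prop :=
  (∀ x, Ω.p (σ x) = x) ∧ Continuous σ ∧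
    ∀ ε : ℝ, 0 < ε → ∃ K : Set Ω.G, IsCompact K ∧ ∀ x ∉ K, Ω.bnorm (σ x) < ε

/-- The Fell bundle is separable: `G` is second countable and the Banach space
`Γ₀(G; B)` is separable (in the supremum norm). -/
def SeparableBundle : Prop :=
  SecondCountableTopology Ω.G ∧
  ∃ D : Set (Ω.G → Ω.T), D.Countable ∧ (∀ σ ∈ D, Ω.IsSecG σ) ∧
    ∀ σ, Ω.IsSecG σ → ∀ ε : ℝ, 0 < ε →
      ∃ τ ∈ D, ∀ x, Ω.bnorm (Ω.badd (σ x) (Ω.bsmul (-1) (τ x))) < ε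

end FellBundleData

namespace FellBundleData

variable {Ω : FellBundleData}

/-- The fibre of a Fell bundle over a point, as a type. -/
@[ext]
structure Fib (Ω : FellBundleData) (x : Ω.G) : Type where
  /-- the underlying point of the total space -/
  val : Ω.T
  proj : Ω.p val = x

namespace Fib

variable {x : Ω.G}

instance : Add (Ω.Fib x) :=
  ⟨fun a b => ⟨Ω.badd a.1 b.1, (Ω.p_badd _ _ (a.2.trans b.2.symm)).trans a.2⟩⟩
instance : SMul ℂ (Ω.Fib x) := ⟨fun c a => ⟨Ω.bsmul c a.1, (Ω.p_bsmul _ _).trans a.2⟩⟩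
instance : Zero (Ω.Fib x) := ⟨⟨Ω.bzero x, Ω.p_bzero x⟩⟩
instance : Neg (Ω.Fib x) := ⟨fun a => (-1 : ℂ) • a⟩
instance : Norm (Ω.Fib x) := ⟨fun a => Ω.bnorm a.1⟩

theorem add_val (a b : Ω.Fib x) : (a + b).1 = Ω.badd a.1 b.1 := rfl
theorem smul_val (c : ℂ) (a : Ω.Fib x) : (c • a).1 = Ω.bsmul c a.1 := rfl
theorem zero_val : (0 : Ω.Fib x).1 = Ω.bzero x := rfl
theorem norm_def (a : Ω.Fib x) : ‖a‖ = Ω.bnorm a.1 := rfl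

theorem add_comm' (a b : Ω.Fib x) : a + b = b + a :=
  Fib.ext (Ω.badd_comm _ _ (a.2.trans b.2.symm))

theorem zero_add' (a : Ω.Fib x) : 0 + a = a := Fib.ext (by
  have := Ω.bzero_badd a.1
  rwa [a.2] at this)

theorem add_neg' (a : Ω.Fib x) : a + -a = 0 := Fib.ext (by
  have := Ω.badd_neg a.1
  rwa [a.2] at this)

instance : AddCommGroup (Ω.Fib x) where
  add_assoc a b c := Fib.ext (Ω.badd_assoc _ _ _ (a.2.trans b.2.symm) (b.2.trans c.2.symm))
  zero_add := zero_add'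
  add_zero a := by rw [add_comm', zero_add']
  add_comm := add_comm'
  neg_add_cancel a := by rw [add_comm', add_neg']
  nsmul := nsmulRec
  zsmul := zsmulRec

instance : Module ℂ (Ω.Fib x) where
  one_smul a := Fib.ext (Ω.one_bsmul _)
  mul_smul c d a := Fib.ext (Ω.mul_bsmul _ _ _)
  smul_zero c := Fib.ext (Ω.bsmul_bzero _ _)
  smul_add c a b := Fib.ext (Ω.bsmul_badd _ _ _ (a.2.trans b.2.symm))
  add_smul c d a := Fib.ext (Ω.add_bsmul _ _ _)
  zero_smul a := Fib.ext ((Ω.zero_bsmul _).trans (by rw [a.2]; rfl))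

theorem normedSpaceCore : NormedSpace.Core ℂ (Ω.Fib x) where
  norm_nonneg a := Ω.bnorm_nonneg _
  norm_smul c a := Ω.bnorm_bsmul _ _
  norm_triangle a b := Ω.bnorm_badd_le _ _ (a.2.trans b.2.symm)
  norm_eq_zero_iff a := by
    rw [norm_def, Ω.bnorm_eq_zero, a.2]
    exact ⟨fun h => Fib.ext h, fun h => congrArg Fib.val h⟩

instance : NormedAddCommGroup (Ω.Fib x) := NormedAddCommGroup.ofCore normedSpaceCore
instance : NormedSpace ℂ (Ω.Fib x) := NormedSpace.ofCore normedSpaceCore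

theorem sub_val (a b : Ω.Fib x) : (a - b).1 = Ω.badd a.1 (Ω.bsmul (-1) b.1) := by
  rw [sub_eq_add_neg, ← neg_one_smul ℂ b]; rfl

theorem norm_sub_def (a b : Ω.Fib x) :
    ‖a - b‖ = Ω.bnorm (Ω.badd a.1 (Ω.bsmul (-1) b.1)) := by
  rw [norm_def, sub_val]

instance : CompleteSpace (Ω.Fib x) := by
  refine Metric.complete_of_cauchySeq_tendsto fun f hf => ?_
  obtain ⟨L, hL, h⟩ := Ω.fiber_complete x (fun n => (f n).1) (fun n => (f n).2) (by
    intro ε hε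
    obtain ⟨N, hN⟩ := Metric.cauchySeq_iff.1 hf ε hε
    refine ⟨N, fun m n hm hn => ?_⟩
    have := hN m hm n hn
    rwa [dist_eq_norm, norm_sub_def] at this)
  refine ⟨⟨L, hL⟩, ?_⟩
  rw [tendsto_iff_norm_sub_tendsto_zero]
  simpa only [norm_sub_def] using h

/-- The norm topology on a fibre is induced from the total space. -/
theorem isInducing_val : Topology.IsInducing (Fib.val : Ω.Fib x → Ω.T) := by
  rw [Topology.isInducing_iff_nhds]
  intro b
  ext s
  rw [mem_comap, Metric.mem_nhds_iff]
  constructor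
  · rintro ⟨ε, hε, hs⟩
    obtain ⟨U, hU, h⟩ := Ω.fiber_nbhd_norm b.1 ε hε
    refine ⟨U, hU, fun c hc => hs ?_⟩
    rw [Metric.mem_ball, dist_eq_norm, norm_sub_def]
    exact h _ hc (c.2.trans b.2.symm)
  · rintro ⟨U, hU, hs⟩
    obtain ⟨ε, hε, h⟩ := Ω.norm_nbhd_fiber b.1 U hU
    refine ⟨ε, hε, fun c hc => hs ?_⟩
    rw [Metric.mem_ball, dist_eq_norm, norm_sub_def] at hc
    exact h _ (c.2.trans b.2.symm) hc

end Fib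

/-- Closed linear spans in a fibre, in terms of the normed space structure. -/
theorem mem_closedSpan_iff [T1Space Ω.G] {x : Ω.G} {S : Set Ω.T} (hS : ∀ t ∈ S, Ω.p t = x)
    {t : Ω.T} : t ∈ Ω.closedSpan x S ↔ ∃ h : Ω.p t = x,
      (⟨t, h⟩ : Ω.Fib x) ∈ (Submodule.span ℂ {s : Ω.Fib x | s.1 ∈ S}).topologicalClosure := by
  have key : Ω.spanIn x S =
      Fib.val '' ((Submodule.span ℂ {s : Ω.Fib x | s.1 ∈ S} : Submodule ℂ (Ω.Fib x)) :
        Set (Ω.Fib x)) := by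
    ext t
    constructor
    · rintro ⟨l, hl, rfl⟩
      induction l with
      | nil => exact ⟨0, Submodule.zero_mem _, rfl⟩
      | cons a l ih =>
        obtain ⟨v, hv, hv'⟩ := ih fun b hb => hl b (List.mem_cons_of_mem _ hb)
        obtain ⟨c, s, hs, rfl⟩ := hl a List.mem_cons_self
        refine ⟨c • (⟨s, hS s hs⟩ : Ω.Fib x) + v,
          Submodule.add_mem _ (Submodule.smul_mem _ _ (Submodule.subset_span hs)) hv, ?_⟩
        rw [List.foldr_cons, ← hv']; rfl
    · rintro ⟨v, hv, rfl⟩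
      have add : ∀ a b : Ω.Fib x, a.1 ∈ Ω.spanIn x S → b.1 ∈ Ω.spanIn x S →
          (a + b).1 ∈ Ω.spanIn x S := by
        rintro a b ⟨l, hl, ha⟩ ⟨m, hm, hb⟩
        refine ⟨l ++ m, fun t ht => (List.mem_append.1 ht).elim (hl t) (hm t), ?_⟩
        rw [List.foldr_append, ← hb, Fib.add_val, ha]
        clear ha hb hm
        have : ∀ c : Ω.Fib x, ∃ d : Ω.Fib x, d.1 = l.foldr Ω.badd (Ω.bzero x) ∧
            (d + c).1 = l.foldr Ω.badd c.1 := by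
          intro c
          induction l with
          | nil => exact ⟨0, rfl, by rw [zero_add]; rfl⟩
          | cons a l ih =>
            obtain ⟨d, hd, hd'⟩ := ih fun b hb => hl b (List.mem_cons_of_mem _ hb)
            obtain ⟨k, s, hs, rfl⟩ := hl a List.mem_cons_self
            refine ⟨k • (⟨s, hS s hs⟩ : Ω.Fib x) + d, by rw [List.foldr_cons, ← hd]; rfl, ?_⟩
            rw [add_assoc, List.foldr_cons, ← hd']; rfl
        obtain ⟨d, hd, hd'⟩ := this b
        rw [← hd, ← hd', Fib.add_val]
      refine Submodule.closure_induction (p := fun v _ => v.1 ∈ Ω.spanIn x S) ⟨[], by simp, rfl⟩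
        (fun a b _ _ ha hb => add a b ha hb) (fun c a ha => ?_) hv
      refine ⟨[Ω.bsmul c a.1], by simpa using ⟨c, a.1, ha, rfl⟩, ?_⟩
      have := add_zero (c • a)
      exact (congrArg Fib.val this).symm
  have hp : ∀ t ∈ Ω.closedSpan x S, Ω.p t = x := by
    intro t ht
    refine closure_minimal ?_ (isClosed_singleton.preimage Ω.p_cont) ht (t := Ω.p ⁻¹' {x})
    rw [key]
    rintro _ ⟨v, -, rfl⟩
    exact v.2
  constructor
  · intro ht
    refine ⟨hp t ht, ?_⟩
    rw [← SetLike.mem_coe, Submodule.topologicalClosure_coe, Fib.isInducing_val.closure_eq_preimage_closure_image,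
      ← key]
    exact ht
  · rintro ⟨h, ht⟩
    rw [← SetLike.mem_coe, Submodule.topologicalClosure_coe, Fib.isInducing_val.closure_eq_preimage_closure_image,
      ← key] at ht
    exact ht

end FellBundleData

namespace LCGroupoid

variable {Γ : LCGroupoid}

/-- The source of an arrow, as a point of the unit space. -/
def srcUnit (x : Γ.G) : Γ.UnitSpace := ⟨Γ.src x, Γ.rng_src x⟩

/-- The range of an arrow, as a point of the unit space. -/
def rngUnit (x : Γ.G) : Γ.UnitSpace := ⟨Γ.rng x, Γ.rng_rng x⟩

theorem srcUnit_val (x : Γ.G) : (srcUnit x).1 = Γ.src x := rfl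
theorem rngUnit_val (x : Γ.G) : (rngUnit x).1 = Γ.rng x := rfl

theorem rng_unit (u : Γ.UnitSpace) : Γ.rng u.1 = u.1 := u.2

theorem src_unit (u : Γ.UnitSpace) : Γ.src u.1 = u.1 := by
  have := Γ.src_rng u.1
  rwa [rng_unit] at this

theorem gmul_unit (u : Γ.UnitSpace) : Γ.gmul u.1 u.1 = u.1 := by
  have := Γ.gmul_rng u.1
  rwa [rng_unit] at this

theorem continuous_rng : Continuous Γ.rng := by
  have h : Continuous fun x : Γ.G =>
      (⟨(x, Γ.ginv x), (Γ.rng_ginv x).symm⟩ : {q : Γ.G × Γ.G // Γ.src q.1 = Γ.rng q.2}) :=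
    (continuous_id.prodMk Γ.cont_ginv).subtype_mk _
  exact (Γ.cont_gmul.comp h).congr Γ.gmul_ginv

theorem continuous_src : Continuous Γ.src :=
  (continuous_rng.comp Γ.cont_ginv).congr Γ.rng_ginv

theorem continuous_rngUnit : Continuous (rngUnit : Γ.G → Γ.UnitSpace) :=
  continuous_rng.subtype_mk _

theorem continuous_srcUnit : Continuous (srcUnit : Γ.G → Γ.UnitSpace) :=
  continuous_src.subtype_mk _

end LCGroupoid

namespace FellBundleData

open LCGroupoid

variable {Ω : FellBundleData}

namespace Fib

section UnitFibre

variable {u : Ω.toLCGroupoid.UnitSpace}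

theorem composable (a b : Ω.Fib u.1) : Ω.src (Ω.p a.1) = Ω.rng (Ω.p b.1) := by
  rw [a.2, b.2, src_unit, rng_unit]

instance : Mul (Ω.Fib u.1) :=
  ⟨fun a b => ⟨Ω.bmul a.1 b.1, by rw [Ω.p_bmul _ _ (composable a b), a.2, b.2, gmul_unit]⟩⟩

instance : Star (Ω.Fib u.1) :=
  ⟨fun a => ⟨Ω.bstar a.1, by rw [Ω.p_bstar, a.2, Ω.ginv_unit _ u.2]⟩⟩

theorem star_val (a : Ω.Fib u.1) : (star a).1 = Ω.bstar a.1 := rfl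

theorem fibre_eq {x : Ω.G} (a b : Ω.Fib x) : Ω.p a.1 = Ω.p b.1 := a.2.trans b.2.symm

instance : NonUnitalRing (Ω.Fib u.1) where
  __ := (inferInstance : AddCommGroup (Ω.Fib u.1))
  left_distrib a b c := Fib.ext (Ω.badd_bmul _ _ _ (fibre_eq b c) (composable a b))
  right_distrib a b c := Fib.ext (Ω.bmul_badd _ _ _ (fibre_eq a b) (composable a c))
  zero_mul a := Fib.ext (by
    have h := Ω.bsmul_bmul 0 a.1 a.1 (composable a a)
    have e : Ω.bsmul 0 a.1 = Ω.bzero u.1 := by rw [Ω.zero_bsmul, a.2]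
    rw [e] at h
    exact h.trans (congrArg Fib.val (zero_smul ℂ (a * a))))
  mul_zero a := Fib.ext (by
    have h := Ω.bmul_bsmul 0 a.1 a.1 (composable a a)
    have e : Ω.bsmul 0 a.1 = Ω.bzero u.1 := by rw [Ω.zero_bsmul, a.2]
    rw [e] at h
    exact h.trans (congrArg Fib.val (zero_smul ℂ (a * a))))
  mul_assoc a b c := Fib.ext (Ω.bmul_assoc _ _ _ (composable a b) (composable b c))

instance : NonUnitalNormedRing (Ω.Fib u.1) where
  __ := (inferInstance : NormedAddCommGroup (Ω.Fib u.1))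
  __ := (inferInstance : NonUnitalRing (Ω.Fib u.1))
  norm_mul_le a b := Ω.unit_submul _ _ (fibre_eq a b) (by rw [a.2, u.2])

instance : StarRing (Ω.Fib u.1) where
  star_involutive _ := Fib.ext (Ω.bstar_bstar _)
  star_mul a b := Fib.ext (Ω.bstar_bmul _ _ (composable a b))
  star_add a b := Fib.ext (Ω.bstar_badd _ _ (fibre_eq a b))

instance : CStarRing (Ω.Fib u.1) where
  norm_mul_self_le a := by
    rw [← sq]; exact (Ω.cstar_identity a.1).ge

instance : IsScalarTower ℂ (Ω.Fib u.1) (Ω.Fib u.1) where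
  smul_assoc c a b := by
    rw [smul_eq_mul, smul_eq_mul]
    exact Fib.ext (Ω.bsmul_bmul _ _ _ (composable a b))

instance : SMulCommClass ℂ (Ω.Fib u.1) (Ω.Fib u.1) where
  smul_comm c a b := by
    rw [smul_eq_mul, smul_eq_mul]
    exact Fib.ext (Ω.bmul_bsmul _ _ _ (composable a b)).symm

instance : StarModule ℂ (Ω.Fib u.1) where
  star_smul _ _ := Fib.ext (Ω.bstar_bsmul _ _)

instance : NonUnitalCStarAlgebra (Ω.Fib u.1) where

end UnitFibre

section Bimodule

variable {x : Ω.G}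

/-- The inner product `b* c ∈ B(s(x))` of `b, c ∈ B(x)`. -/
def ip (b c : Ω.Fib x) : Ω.Fib (srcUnit x).1 :=
  ⟨Ω.bmul (Ω.bstar b.1) c.1, by
    rw [Ω.p_bmul _ _ (by rw [Ω.p_bstar, b.2, c.2, Ω.src_ginv]), Ω.p_bstar, b.2, c.2,
      Ω.ginv_gmul, srcUnit_val]⟩

/-- The inner product `b c* ∈ B(r(x))` of `b, c ∈ B(x)`. -/
def lip (b c : Ω.Fib x) : Ω.Fib (rngUnit x).1 :=
  ⟨Ω.bmul b.1 (Ω.bstar c.1), by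
    rw [Ω.p_bmul _ _ (by rw [Ω.p_bstar, b.2, c.2, Ω.rng_ginv]), Ω.p_bstar, b.2, c.2,
      Ω.gmul_ginv, rngUnit_val]⟩

/-- The left action of `B(r(x))` on `B(x)`. -/
def lact (a : Ω.Fib (rngUnit x).1) (b : Ω.Fib x) : Ω.Fib x :=
  ⟨Ω.bmul a.1 b.1, by
    rw [Ω.p_bmul _ _ (by rw [a.2, b.2, rngUnit_val, Ω.src_rng]), a.2, b.2, rngUnit_val,
      Ω.gmul_rng]⟩

/-- The right action of `B(s(x))` on `B(x)`. -/
def ract (b : Ω.Fib x) (a : Ω.Fib (srcUnit x).1) : Ω.Fib x :=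
  ⟨Ω.bmul b.1 a.1, by
    rw [Ω.p_bmul _ _ (by rw [a.2, b.2, srcUnit_val, Ω.rng_src]), a.2, b.2, srcUnit_val,
      Ω.gmul_src]⟩

variable (a a' : Ω.Fib (rngUnit x).1) (b b' c c' : Ω.Fib x) (d d' : Ω.Fib (srcUnit x).1) (k : ℂ)

theorem ip_add : ip b (c + c') = ip b c + ip b c' :=
  Fib.ext (Ω.badd_bmul _ _ _ (fibre_eq c c') (by rw [Ω.p_bstar, b.2, c.2, Ω.src_ginv]))

theorem ip_smul : ip b (k • c) = k • ip b c :=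
  Fib.ext (Ω.bmul_bsmul _ _ _ (by rw [Ω.p_bstar, b.2, c.2, Ω.src_ginv]))

theorem star_ip : star (ip b c) = ip c b :=
  Fib.ext (by
    have := Ω.bstar_bmul (Ω.bstar b.1) c.1 (by rw [Ω.p_bstar, b.2, c.2, Ω.src_ginv])
    rwa [Ω.bstar_bstar] at this)

theorem add_ip : ip (b + b') c = ip b c + ip b' c := by
  rw [← star_ip, ip_add, star_add, star_ip, star_ip]

theorem smul_ip : ip (k • b) c = star k • ip b c := by
  rw [← star_ip, ip_smul, star_smul, star_ip]

theorem lact_add : lact a (b + b') = lact a b + lact a b' :=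
  Fib.ext (Ω.badd_bmul _ _ _ (fibre_eq b b') (by rw [a.2, b.2, rngUnit_val, Ω.src_rng]))

theorem lact_smul : lact a (k • b) = k • lact a b :=
  Fib.ext (Ω.bmul_bsmul _ _ _ (by rw [a.2, b.2, rngUnit_val, Ω.src_rng]))

theorem add_lact : lact (a + a') b = lact a b + lact a' b :=
  Fib.ext (Ω.bmul_badd _ _ _ (fibre_eq a a') (by rw [a.2, b.2, rngUnit_val, Ω.src_rng]))

theorem smul_lact : lact (k • a) b = k • lact a b :=
  Fib.ext (Ω.bsmul_bmul _ _ _ (by rw [a.2, b.2, rngUnit_val, Ω.src_rng]))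

theorem mul_lact : lact (a * a') b = lact a (lact a' b) :=
  Fib.ext (Ω.bmul_assoc _ _ _ (composable a a') (by rw [a'.2, b.2, rngUnit_val, Ω.src_rng]))

theorem lact_ract : lact a (ract b d) = ract (lact a b) d :=
  Fib.ext (Ω.bmul_assoc _ _ _ (by rw [a.2, b.2, rngUnit_val, Ω.src_rng])
    (by rw [d.2, b.2, srcUnit_val, Ω.rng_src])).symm

theorem ip_ract : ip b (ract c d) = ip b c * d :=
  Fib.ext (Ω.bmul_assoc _ _ _ (by rw [Ω.p_bstar, b.2, c.2, Ω.src_ginv])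
    (by rw [d.2, c.2, srcUnit_val, Ω.rng_src])).symm

theorem ract_ip : ip (ract b d) c = star d * ip b c := by
  rw [← star_ip, ip_ract, star_mul, star_ip]

theorem lact_lip : lip (lact a b) c = a * lip b c :=
  Fib.ext (Ω.bmul_assoc _ _ _ (by rw [a.2, b.2, rngUnit_val, Ω.src_rng])
    (by rw [Ω.p_bstar, b.2, c.2, Ω.rng_ginv]))

theorem lip_lact_eq : lact (lip b c) c' = ract b (ip c c') :=
  Fib.ext (Ω.bmul_assoc _ _ _ (by rw [Ω.p_bstar, b.2, c.2, Ω.rng_ginv])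
    (by rw [Ω.p_bstar, c'.2, c.2, Ω.src_ginv]))

theorem ip_lact : ip b (lact a c) = ip (lact (star a) b) c :=
  Fib.ext (by
    have := Ω.bstar_bmul (star a).1 b.1 (by rw [(star a).2, b.2, rngUnit_val, Ω.src_rng])
    rw [star_val, Ω.bstar_bstar] at this
    change Ω.bmul (Ω.bstar b.1) (Ω.bmul a.1 c.1) = Ω.bmul (Ω.bstar (Ω.bmul (star a).1 b.1)) c.1
    rw [star_val, this]
    exact (Ω.bmul_assoc _ _ _ (by rw [Ω.p_bstar, b.2, a.2, Ω.src_ginv, rngUnit_val, Ω.rng_rng])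
      (by rw [a.2, c.2, rngUnit_val, Ω.src_rng])).symm)

theorem exists_ip_self_eq : ∃ d : Ω.Fib (srcUnit x).1, ip b b = star d * d := by
  obtain ⟨c, hc, h⟩ := Ω.bmul_pos b.1
  exact ⟨⟨c, by rw [hc, b.2, srcUnit_val]⟩, Fib.ext h⟩

end Bimodule

end Fib

end FellBundleData

section CStarAlgebra

variable {A : Type*} [NonUnitalCStarAlgebra A]

/-- In the unitization, `m = √‖k‖ - √(‖k‖ - k)`, so that `(√‖k‖ - m)² = ‖k‖ - k`. -/
theorem IsSelfAdjoint.exists_smul_sub_mul_eq {k : A} (hk : IsSelfAdjoint k) :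
    ∃ m : A, star m = m ∧ (2 * √‖k‖ : ℝ) • m - m * m = k := by
  set N := ‖k‖
  have hN : 0 ≤ N := norm_nonneg k
  set f : ℝ → ℝ := fun t => √N - √(N - t) with hf
  have f0 : f 0 = 0 := by simp [hf]
  have fc : Continuous f := by fun_prop
  refine ⟨cfcₙ f k, (cfcₙ_predicate f k).star_eq, ?_⟩
  have h1 := cfcₙ_const_mul (2 * √N) f k fc.continuousOn f0
  have h2 := cfcₙ_mul f f k fc.continuousOn f0 fc.continuousOn f0
  have h3 := cfcₙ_sub (fun t => 2 * √N * f t) (fun t => f t * f t) k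
    (by fun_prop) (by simp [f0]) (by fun_prop) (by simp [f0])
  rw [← h1, ← h2, ← h3]
  conv_rhs => rw [← cfcₙ_id' ℝ k]
  refine cfcₙ_congr fun t ht => ?_
  have ht' : t ≤ N := (le_abs_self t).trans (NonUnitalIsometricContinuousFunctionalCalculus.norm_quasispectrum_le k ht)
  have e1 := Real.mul_self_sqrt hN
  have e2 := Real.mul_self_sqrt (sub_nonneg.2 ht')
  simp only [hf]
  linear_combination e1 - e2

/-- A closed set contains `a` as soon as it contains all products `e * a * f`. -/
theorem IsClosed.mem_of_forall_mul_mul_mem {M : Set A} (hM : IsClosed M) {a : A}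
    (h : ∀ e f : A, e * a * f ∈ M) : a ∈ M := by
  let _ := CStarAlgebra.spectralOrder A
  have := CStarAlgebra.spectralOrderedRing A
  have hu := CStarAlgebra.increasingApproximateUnit (A := A)
  have h1 : ∀ f : A, a * f ∈ M := fun f =>
    hM.mem_of_tendsto (hu.tendsto_mul_right (a * f))
      (Eventually.of_forall fun e => by simpa only [mul_assoc] using h e f)
  exact hM.mem_of_tendsto (hu.tendsto_mul_left a) (Eventually.of_forall h1)

end CStarAlgebra

namespace FellBundleData

open LCGroupoid

variable {Ω : FellBundleData}

/-- The Fell bundle multiplication is continuous along continuous composable families. -/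
theorem continuous_bmul {α : Type*} [TopologicalSpace α] {f g : α → Ω.T} (hf : Continuous f)
    (hg : Continuous g) (h : ∀ i, Ω.src (Ω.p (f i)) = Ω.rng (Ω.p (g i))) :
    Continuous fun i => Ω.bmul (f i) (g i) :=
  Ω.cont_bmul.comp ((hf.prodMk hg).subtype_mk h)

/-- Fibrewise addition is continuous along continuous families. -/
theorem continuous_badd {α : Type*} [TopologicalSpace α] {f g : α → Ω.T} (hf : Continuous f)
    (hg : Continuous g) (h : ∀ i, Ω.p (f i) = Ω.p (g i)) :
    Continuous fun i => Ω.badd (f i) (g i) :=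
  Ω.cont_badd.comp ((hf.prodMk hg).subtype_mk h)

theorem continuous_bsmul {α : Type*} [TopologicalSpace α] {k : α → ℂ} {f : α → Ω.T}
    (hk : Continuous k) (hf : Continuous f) : Continuous fun i => Ω.bsmul (k i) (f i) :=
  Ω.cont_bsmul.comp (hk.prodMk hf)

namespace Fib

theorem continuous_val {x : Ω.G} : Continuous (Fib.val : Ω.Fib x → Ω.T) :=
  isInducing_val.continuous

theorem continuous_ip_lact {x : Ω.G} (b c : Ω.Fib x) :
    Continuous fun a : Ω.Fib (rngUnit x).1 => ip b (lact a c) := by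
  rw [isInducing_val.continuous_iff]
  refine continuous_bmul continuous_const
    (continuous_bmul continuous_val continuous_const fun a => ?_) fun a => ?_
  · rw [a.2, c.2, rngUnit_val, Ω.src_rng]
  · rw [Ω.p_bstar, b.2, (lact a c).2, Ω.src_ginv]

end Fib

end FellBundleData

namespace FellBundle

open LCGroupoid FellBundleData FellBundleData.Fib

variable (Ω : FellBundle)

theorem topologicalClosure_span_ip (x : Ω.G) :
    (Submodule.span ℂ {t : Ω.Fib (srcUnit x).1 | ∃ b c : Ω.Fib x, t = ip b c}).topologicalClosure
      = ⊤ := by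
  have := Ω.t2G
  have h := Ω.saturated (Ω.ginv x) x (Ω.src_ginv x)
  rw [Ω.ginv_gmul] at h
  refine eq_top_iff.2 fun t _ => ?_
  have ht : t.1 ∈ Ω.closedSpan (Ω.src x)
      {t | ∃ a b, Ω.p a = Ω.ginv x ∧ Ω.p b = x ∧ t = Ω.bmul a b} := h ▸ t.2
  rw [mem_closedSpan_iff] at ht
  · obtain ⟨_, ht⟩ := ht
    refine Submodule.topologicalClosure_mono (Submodule.span_mono ?_) ht
    rintro s ⟨a, b, ha, hb, hs⟩
    refine ⟨⟨Ω.bstar a, by rw [Ω.p_bstar, ha, Ω.ginv_ginv]⟩, ⟨b, hb⟩, Fib.ext ?_⟩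
    exact hs.trans (congrArg (fun t => Ω.bmul t b) (Ω.bstar_bstar a).symm)
  · rintro _ ⟨a, b, ha, hb, rfl⟩
    rw [Ω.p_bmul _ _ (by rw [ha, hb, Ω.src_ginv]), ha, hb, Ω.ginv_gmul]

theorem topologicalClosure_span_lip (x : Ω.G) :
    (Submodule.span ℂ {t : Ω.Fib (rngUnit x).1 | ∃ b c : Ω.Fib x, t = lip b c}).topologicalClosure
      = ⊤ := by
  have := Ω.t2G
  have h := Ω.saturated x (Ω.ginv x) (Ω.rng_ginv x).symm
  rw [Ω.gmul_ginv] at h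
  refine eq_top_iff.2 fun t _ => ?_
  have ht : t.1 ∈ Ω.closedSpan (Ω.rng x)
      {t | ∃ a b, Ω.p a = x ∧ Ω.p b = Ω.ginv x ∧ t = Ω.bmul a b} := h ▸ t.2
  rw [mem_closedSpan_iff] at ht
  · obtain ⟨_, ht⟩ := ht
    refine Submodule.topologicalClosure_mono (Submodule.span_mono ?_) ht
    rintro s ⟨a, b, ha, hb, hs⟩
    refine ⟨⟨a, ha⟩, ⟨Ω.bstar b, by rw [Ω.p_bstar, hb, Ω.ginv_ginv]⟩, Fib.ext ?_⟩
    exact hs.trans (congrArg (Ω.bmul a) (Ω.bstar_bstar b).symm)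
  · rintro _ ⟨a, b, ha, hb, rfl⟩
    rw [Ω.p_bmul _ _ (by rw [ha, hb, Ω.rng_ginv]), ha, hb, Ω.gmul_ginv]

variable {Ω}

/-- The induced ideal of a closed ideal `P` of `B(s(x))` consists of those `a ∈ B(r(x))` with
`b* a c ∈ P` for all `b, c ∈ B(x)`. -/
theorem mem_hIdeal_iff {x : Ω.G} {P : Submodule ℂ (Ω.Fib (srcUnit x).1)}
    (hP : IsClosed (P : Set (Ω.Fib (srcUnit x).1)))
    (hl : ∀ a, ∀ d ∈ P, a * d ∈ P) (hr : ∀ a, ∀ d ∈ P, d * a ∈ P) {a : Ω.Fib (rngUnit x).1} :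
    a.1 ∈ Ω.hIdeal x (Fib.val '' (P : Set (Ω.Fib (srcUnit x).1))) ↔
      ∀ b c : Ω.Fib x, ip b (lact a c) ∈ P := by
  have := Ω.t2G
  set S : Set Ω.T := {t | ∃ a b d, Ω.p a = x ∧ Ω.p b = x ∧
    d ∈ Fib.val '' (P : Set (Ω.Fib (srcUnit x).1)) ∧ t = Ω.bmul (Ω.bmul a d) (Ω.bstar b)}
  have hS : ∀ t ∈ S, ∃ b c : Ω.Fib x, ∃ d ∈ P, t = (lip (ract b d) c).1 := by
    rintro _ ⟨b, c, _, hb, hc, ⟨d, hd, rfl⟩, rfl⟩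
    exact ⟨⟨b, hb⟩, ⟨c, hc⟩, d, hd, rfl⟩
  have key : a.1 ∈ Ω.hIdeal x (Fib.val '' (P : Set (Ω.Fib (srcUnit x).1))) ↔
      a ∈ (Submodule.span ℂ {s : Ω.Fib (rngUnit x).1 | s.1 ∈ S}).topologicalClosure := by
    refine (mem_closedSpan_iff (x := (rngUnit x).1) fun t ht => ?_).trans
      ⟨fun ⟨_, h⟩ => h, fun h => ⟨a.2, h⟩⟩
    obtain ⟨b, c, d, -, rfl⟩ := hS t ht
    exact (lip (ract b d) c).2
  rw [key]
  constructor
  · intro h b c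
    have hc : IsClosed {a : Ω.Fib (rngUnit x).1 | ip b (lact a c) ∈ P} :=
      hP.preimage (continuous_ip_lact b c)
    refine closure_minimal (fun a ha => ?_) hc h
    refine Submodule.span_induction (p := fun a _ => ip b (lact a c) ∈ P) ?_ ?_ ?_ ?_ ha
    · intro s hs
      obtain ⟨b', c', d, hd, e⟩ := hS _ hs
      rw [Fib.ext e, lip_lact_eq, ip_ract, ip_ract]
      exact hr _ _ (hl _ _ hd)
    · have := smul_lact (0 : Ω.Fib (rngUnit x).1) c 0
      rw [zero_smul, zero_smul] at this
      rw [this]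
      have := ip_smul b c 0
      rw [zero_smul, zero_smul] at this
      rw [this]
      exact P.zero_mem
    · intro a a' _ _ h h'
      rw [add_lact, ip_add]
      exact P.add_mem h h'
    · intro k a _ h
      rw [smul_lact, ip_smul]
      exact P.smul_mem _ h
  · intro h
    set M := (Submodule.span ℂ {s : Ω.Fib (rngUnit x).1 | s.1 ∈ S}).topologicalClosure
    have hM : IsClosed (M : Set (Ω.Fib (rngUnit x).1)) := Submodule.isClosed_topologicalClosure _
    have ind : ∀ N : Submodule ℂ (Ω.Fib (rngUnit x).1), IsClosed (N : Set (Ω.Fib (rngUnit x).1)) →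
        (∀ b c : Ω.Fib x, lip b c ∈ N) → ∀ e, e ∈ N := by
      intro N hN hbc e
      have : e ∈ (⊤ : Submodule ℂ (Ω.Fib (rngUnit x).1)) := trivial
      rw [← Ω.topologicalClosure_span_lip x] at this
      refine Submodule.topologicalClosure_minimal _ (Submodule.span_le.2 ?_) hN this
      rintro _ ⟨b, c, rfl⟩
      exact hbc b c
    refine hM.mem_of_forall_mul_mul_mem fun e f => ?_
    refine ind (M.comap (LinearMap.mulRight ℂ f ∘ₗ LinearMap.mulRight ℂ a))
      (hM.preimage (f := fun e => e * a * f) (by fun_prop)) (fun b c => ?_) e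
    refine ind (M.comap (LinearMap.mulLeft ℂ (lip b c * a)))
      (hM.preimage (f := fun f => lip b c * a * f) (by fun_prop)) (fun b' c' => ?_) f
    change lip b c * a * lip b' c' ∈ M
    refine Submodule.le_topologicalClosure _ (Submodule.subset_span ?_)
    rw [mul_assoc, ← lact_lip, ← lact_lip, lip_lact_eq]
    exact ⟨b.1, c'.1, _, b.2, c'.2, ⟨_, h c b', rfl⟩, rfl⟩

end FellBundle

namespace FellBundleData

open LCGroupoid Fib
open scoped InnerProductSpace

variable {Ω : FellBundleData} {x : Ω.G} {H : Type} [NormedAddCommGroup H] [InnerProductSpace ℂ H]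
  [CompleteSpace H]

set_option linter.unusedVariables false in
/-- The fibre `B(x)`, to be endowed with the semi-inner product `⟨h, π(b* c) h⟩`. -/
def PreInd (π : Ω.Fib (srcUnit x).1 →⋆ₙₐ[ℂ] (H →L[ℂ] H)) (h : H) : Type := Ω.Fib x

variable (π : Ω.Fib (srcUnit x).1 →⋆ₙₐ[ℂ] (H →L[ℂ] H)) (h : H)

namespace PreInd

instance : AddCommGroup (PreInd π h) := inferInstanceAs (AddCommGroup (Ω.Fib x))
instance : Module ℂ (PreInd π h) := inferInstanceAs (Module ℂ (Ω.Fib x))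

/-- The identity map from the fibre. -/
def of : Ω.Fib x ≃ₗ[ℂ] PreInd π h := LinearEquiv.refl ℂ _

theorem inner_apply_star_mul (d d' : Ω.Fib (srcUnit x).1) (v w : H) :
    ⟪v, π (star d * d') w⟫_ℂ = ⟪π d v, π d' w⟫_ℂ := by
  rw [map_mul, map_star, mul_apply_eq_comp, ContinuousLinearMap.star_eq_adjoint,
    ContinuousLinearMap.adjoint_inner_right]

/-- The semi-inner product on the fibre. -/
abbrev core : PreInnerProductSpace.Core ℂ (PreInd π h) where
  inner b c := ⟪h, π (ip ((of π h).symm b) ((of π h).symm c)) h⟫_ℂ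
  conj_inner_symm b c := by
    rw [inner_conj_symm, ← star_ip, map_star, ContinuousLinearMap.star_eq_adjoint,
      ContinuousLinearMap.adjoint_inner_left]
  re_inner_nonneg b := by
    obtain ⟨d, hd⟩ := exists_ip_self_eq ((of π h).symm b)
    rw [hd, inner_apply_star_mul]
    exact inner_self_nonneg
  add_left b b' c := by
    rw [map_add, add_ip, map_add, _root_.add_apply, inner_add_right]
  smul_left b c k := by
    rw [map_smul, smul_ip, map_smul, _root_.smul_apply, inner_smul_right]
    rfl

instance : SeminormedAddCommGroup (PreInd π h) :=
  InnerProductSpace.Core.toSeminormedAddCommGroup (c := core π h)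
instance : InnerProductSpace ℂ (PreInd π h) := InnerProductSpace.ofCore (core π h)

theorem inner_of (b c : Ω.Fib x) : ⟪of π h b, of π h c⟫_ℂ = ⟪h, π (ip b c) h⟫_ℂ := rfl

theorem norm_of_lact_le (a : Ω.Fib (rngUnit x).1) (b : Ω.Fib x) :
    ‖of π h (lact a b)‖ ≤ ‖a‖ * ‖of π h b‖ := by
  obtain ⟨m, hm, e⟩ := (IsSelfAdjoint.star_mul_self a).exists_smul_sub_mul_eq
  have hN : √‖star a * a‖ = ‖a‖ := by rw [CStarRing.norm_star_mul_self, Real.sqrt_mul_self (norm_nonneg _)]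
  rw [hN] at e
  have e1 : ⟪of π h (lact a b), of π h (lact a b)⟫_ℂ = ⟪of π h b, of π h (lact (star a * a) b)⟫_ℂ := by
    rw [inner_of, inner_of, mul_lact, ip_lact _ b, star_star]
  have e2 : ⟪of π h (lact m b), of π h (lact m b)⟫_ℂ = ⟪of π h b, of π h (lact (m * m) b)⟫_ℂ := by
    rw [inner_of, inner_of, mul_lact, ip_lact _ b, hm]
  have e3 : ⟪of π h (lact m b), of π h b⟫_ℂ = ⟪of π h b, of π h (lact m b)⟫_ℂ := by
    rw [inner_of, inner_of, ip_lact, hm]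
  have e4 : lact (star a * a) b = (2 * ‖a‖ : ℂ) • lact m b - lact (m * m) b := by
    rw [eq_sub_iff_add_eq, ← add_lact, ← smul_lact]
    congr 1
    rw [← e]
    simp [← Complex.coe_smul]
  have key : (‖a‖ * ‖of π h b‖) ^ 2 - ‖of π h (lact a b)‖ ^ 2 =
      ‖of π h ((‖a‖ : ℂ) • b - lact m b)‖ ^ 2 := by
    apply Complex.ofReal_injective
    have sq : ∀ v : PreInd π h, ((‖v‖ ^ 2 : ℝ) : ℂ) = ⟪v, v⟫_ℂ := fun v => by
      rw [inner_self_eq_norm_sq_to_K]; simp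
    rw [mul_pow, Complex.ofReal_sub, Complex.ofReal_mul, sq, sq, sq, e1, e4, map_sub, map_sub,
      map_smul, map_smul, inner_sub_left, inner_sub_right, inner_sub_right, inner_sub_right,
      inner_smul_left, inner_smul_left, inner_smul_right, inner_smul_right, inner_smul_right,
      e2, e3, Complex.conj_ofReal]
    push_cast
    ring
  have := sq_nonneg ‖of π h ((‖a‖ : ℂ) • b - lact m b)‖
  exact le_of_sq_le_sq (by linarith) (by positivity)

/-- The left action of `B(r(x))`. -/
def lactL (a : Ω.Fib (rngUnit x).1) : PreInd π h →L[ℂ] PreInd π h :=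
  LinearMap.mkContinuous
    { toFun := fun b => of π h (lact a ((of π h).symm b))
      map_add' := fun b c => by rw [map_add, lact_add, map_add]
      map_smul' := fun k b => by rw [map_smul, lact_smul, map_smul]; rfl } ‖a‖
    fun b => norm_of_lact_le π h a ((of π h).symm b)

end PreInd

end FellBundleData

namespace FellBundleData

open LCGroupoid Fib UniformSpace
open scoped InnerProductSpace

variable {Ω : FellBundleData} {x : Ω.G} {H : Type} [NormedAddCommGroup H] [InnerProductSpace ℂ H]
  [CompleteSpace H]

variable (π : Ω.Fib (srcUnit x).1 →⋆ₙₐ[ℂ] (H →L[ℂ] H)) (h : H)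

/-- The Hilbert space of the representation of `B(r(x))` induced by `π`. -/
abbrev Ind : Type := Completion (PreInd π h)

/-- The class of an element of `B(x)` in the induced Hilbert space. -/
def cls : Ω.Fib x →ₗ[ℂ] Ind π h := (Completion.toComplL (𝕜 := ℂ)).toLinearMap ∘ₗ (PreInd.of π h).toLinearMap

theorem denseRange_cls : DenseRange (cls π h) :=
  Completion.denseRange_coe (α := PreInd π h)

theorem inner_cls (b c : Ω.Fib x) : ⟪cls π h b, cls π h c⟫_ℂ = ⟪h, π (ip b c) h⟫_ℂ :=
  (Completion.inner_coe _ _).trans (PreInd.inner_of π h b c)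

variable {π h} in
theorem ext_cls {E : Type*} [NormedAddCommGroup E] [NormedSpace ℂ E] {f g : Ind π h →L[ℂ] E}
    (hfg : ∀ b, f (cls π h b) = g (cls π h b)) : f = g :=
  DFunLike.coe_injective ((denseRange_cls π h).equalizer f.continuous g.continuous (funext hfg))

variable {π h} in
theorem ext_inner_cls {v w : Ind π h} (hvw : ∀ b, ⟪v, cls π h b⟫_ℂ = ⟪w, cls π h b⟫_ℂ) : v = w :=
  ext_inner_right ℂ fun z => (denseRange_cls π h).induction_on z
    (isClosed_eq (by fun_prop) (by fun_prop)) hvw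

theorem completion_lactL_cls (a : Ω.Fib (rngUnit x).1) (b : Ω.Fib x) :
    (PreInd.lactL π h a).completion (cls π h b) = cls π h (lact a b) :=
  (PreInd.lactL π h a).completion_apply_coe _

/-- The induced representation of `B(r(x))`. -/
def indRep : Ω.Fib (rngUnit x).1 →⋆ₙₐ[ℂ] (Ind π h →L[ℂ] Ind π h) where
  toFun a := (PreInd.lactL π h a).completion
  map_smul' k a := ext_cls fun b => by
    simp only [completion_lactL_cls, smul_lact, map_smul, _root_.smul_apply, MonoidHom.id_apply]
  map_zero' := ext_cls fun b => by
    have := smul_lact (0 : Ω.Fib (rngUnit x).1) b 0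
    rw [zero_smul, zero_smul] at this
    simp only [completion_lactL_cls, this, map_zero, _root_.zero_apply]
  map_add' a a' := ext_cls fun b => by
    simp only [completion_lactL_cls, add_lact, map_add, _root_.add_apply]
  map_mul' a a' := ext_cls fun b => by
    simp only [completion_lactL_cls, mul_lact, mul_apply_eq_comp]
  map_star' a := ext_cls fun b => ext_inner_cls fun c => by
    rw [ContinuousLinearMap.star_eq_adjoint, ContinuousLinearMap.adjoint_inner_left,
      completion_lactL_cls, completion_lactL_cls, inner_cls, inner_cls, ip_lact]

theorem indRep_cls (a : Ω.Fib (rngUnit x).1) (b : Ω.Fib x) :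
    indRep π h a (cls π h b) = cls π h (lact a b) :=
  completion_lactL_cls π h a b

theorem norm_apply_ip_le (b c : Ω.Fib x) :
    ‖π (ip b c) h‖ ≤ √‖lip b b‖ * ‖PreInd.of π h c‖ := by
  have e : ⟪π (ip b c) h, π (ip b c) h⟫_ℂ =
      ⟪PreInd.of π h c, PreInd.of π h (lact (lip b b) c)⟫_ℂ := by
    rw [PreInd.inner_of, lip_lact_eq, ip_ract, ← PreInd.inner_apply_star_mul, star_ip]
  refine le_of_sq_le_sq ?_ (by positivity)
  rw [mul_pow, Real.sq_sqrt (norm_nonneg _)]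
  calc ‖π (ip b c) h‖ ^ 2 = ‖⟪π (ip b c) h, π (ip b c) h⟫_ℂ‖ := by
        rw [inner_self_eq_norm_sq_to_K]; simp
    _ ≤ ‖PreInd.of π h c‖ * ‖PreInd.of π h (lact (lip b b) c)‖ := by
        rw [e]; exact norm_inner_le_norm _ _
    _ ≤ ‖PreInd.of π h c‖ * (‖lip b b‖ * ‖PreInd.of π h c‖) := by
        gcongr; exact PreInd.norm_of_lact_le π h _ _
    _ = _ := by ring

/-- The operator `[c] ↦ π(b* c) h`. -/
def indToH (b : Ω.Fib x) : Ind π h →L[ℂ] H :=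
  (LinearMap.mkContinuous
    { toFun := fun c => π (ip b ((PreInd.of π h).symm c)) h
      map_add' := fun c d => by rw [map_add, ip_add, map_add, _root_.add_apply]
      map_smul' := fun k c => by
        rw [map_smul, ip_smul, map_smul, _root_.smul_apply, RingHom.id_apply] }
    (√‖lip b b‖) fun c => norm_apply_ip_le π h b ((PreInd.of π h).symm c)).fromCompletion

theorem indToH_cls (b c : Ω.Fib x) : indToH π h b (cls π h c) = π (ip b c) h :=
  ContinuousLinearMap.fromCompletion_apply_coe _ _

open ContinuousLinearMap in
theorem adjoint_indToH_apply (b : Ω.Fib x) (d : Ω.Fib (srcUnit x).1) :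
    adjoint (indToH π h b) (π d h) = cls π h (ract b d) :=
  ext_inner_cls fun c => by
    rw [adjoint_inner_left, indToH_cls, inner_cls, ract_ip, PreInd.inner_apply_star_mul]

open ContinuousLinearMap in
theorem adjoint_indToH_self (b : Ω.Fib x) : adjoint (indToH π h b) h = cls π h b :=
  ext_inner_cls fun c => by rw [adjoint_inner_left, indToH_cls, inner_cls]

open ContinuousLinearMap in
theorem adjoint_indToH_rep (b : Ω.Fib x) (d : Ω.Fib (srcUnit x).1) (v : H) :
    adjoint (indToH π h b) (π d v) = adjoint (indToH π h (ract b d)) v :=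
  ext_inner_cls fun c => by
    rw [adjoint_inner_left, adjoint_inner_left, indToH_cls, indToH_cls, ract_ip, map_mul, map_star,
      mul_apply_eq_comp, star_eq_adjoint, adjoint_inner_right]

open ContinuousLinearMap in
theorem adjoint_indToH_comp (b c : Ω.Fib x) (v : Ind π h) :
    adjoint (indToH π h b) (indToH π h c v) = indRep π h (lip b c) v := by
  refine DFunLike.congr_fun (f := adjoint (indToH π h b) ∘L indToH π h c) (ext_cls fun d => ?_) v
  rw [comp_apply, indToH_cls, adjoint_indToH_apply, indRep_cls, lip_lact_eq]

variable {π h}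

open ContinuousLinearMap in
theorem indToH_adjoint (hh : DenseRange fun d => π d h) (a : Ω.Fib (rngUnit x).1) (b c : Ω.Fib x) :
    indToH π h b ∘L indRep π h a ∘L adjoint (indToH π h c) = π (ip b (lact a c)) := by
  refine DFunLike.coe_injective (hh.equalizer (map_continuous _) (map_continuous _)
    (funext fun d => ?_))
  simp only [Function.comp_apply, comp_apply]
  rw [adjoint_indToH_apply, indRep_cls, indToH_cls, lact_ract, ip_ract, map_mul]
  rfl

/-- The kernel of the induced representation. -/
theorem indRep_eq_zero_iff (hh : DenseRange fun d => π d h) (a : Ω.Fib (rngUnit x).1) :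
    indRep π h a = 0 ↔ ∀ b c, π (ip b (lact a c)) = 0 := by
  constructor
  · intro h0 b c
    rw [← indToH_adjoint hh, h0, ContinuousLinearMap.zero_comp, ContinuousLinearMap.comp_zero]
  · refine fun h0 => ext_cls fun c => ext_inner_cls fun b => ?_
    rw [← inner_conj_symm, indRep_cls, inner_cls, h0]
    simp

/-- The induced representation of an irreducible representation is irreducible. -/
theorem indRep_irreducible
    (hπ : ∀ K : Submodule ℂ H, IsClosed (K : Set H) → (∀ d, ∀ v ∈ K, π d v ∈ K) → K = ⊥ ∨ K = ⊤)
    (K : Submodule ℂ (Ind π h)) (hK : IsClosed (K : Set (Ind π h)))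
    (hK' : ∀ a, ∀ v ∈ K, indRep π h a v ∈ K) : K = ⊥ ∨ K = ⊤ := by
  let T : Ω.Fib x → H →L[ℂ] Ind π h := fun c => ContinuousLinearMap.adjoint (indToH π h c)
  have mem : ∀ v, v ∈ (⨅ c, K.comap (T c).toLinearMap) ↔ ∀ c, T c v ∈ K := fun v => by
    simp [Submodule.mem_iInf]
  have hcl : IsClosed ((⨅ c, K.comap (T c).toLinearMap : Submodule ℂ H) : Set H) := by
    rw [Submodule.coe_iInf]
    exact isClosed_iInter fun c => hK.preimage (T c).continuous
  have hinv : ∀ d, ∀ v ∈ (⨅ c, K.comap (T c).toLinearMap),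
      π d v ∈ (⨅ c, K.comap (T c).toLinearMap) := by
    intro d v hv
    rw [mem] at hv ⊢
    intro c
    have := hv (ract c d)
    rwa [← adjoint_indToH_rep] at this
  rcases hπ _ hcl hinv with h0 | h0
  · left
    rw [Submodule.eq_bot_iff]
    intro k hk
    refine ext_inner_cls fun b => ?_
    have : indToH π h b k = 0 := by
      rw [← Submodule.mem_bot ℂ, ← h0, mem]
      intro c
      rw [adjoint_indToH_comp]
      exact hK' _ _ hk
    rw [← adjoint_indToH_self, ContinuousLinearMap.adjoint_inner_right, this, inner_zero_left,
      inner_zero_left]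
  · right
    have hcls : ∀ c, cls π h c ∈ K := fun c => by
      rw [← adjoint_indToH_self]
      exact (mem h).1 (h0 ▸ trivial) c
    rw [eq_top_iff]
    intro v _
    exact (denseRange_cls π h).induction_on v hK hcls

end FellBundleData

namespace FellBundle

open LCGroupoid FellBundleData FellBundleData.Fib

variable {Ω : FellBundle} {x : Ω.G} {H : Type} [NormedAddCommGroup H] [InnerProductSpace ℂ H]
  [CompleteSpace H]

open scoped CStarAlgebra in
/-- The induced representation of a nonzero representation is nonzero. -/
theorem exists_indRep_ne_zero {π : Ω.Fib (srcUnit x).1 →⋆ₙₐ[ℂ] (H →L[ℂ] H)} {h : H}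
    (hh : DenseRange fun d => π d h) (hπ : ∃ d, π d ≠ 0) : ∃ a, indRep π h a ≠ 0 := by
  by_contra! h0
  obtain ⟨d, hd⟩ := hπ
  refine hd ?_
  have hc : IsClosed {d | π d = 0} := isClosed_eq (map_continuous π) continuous_const
  have : d ∈ (⊤ : Submodule ℂ (Ω.Fib (srcUnit x).1)) := trivial
  rw [← Ω.topologicalClosure_span_ip x] at this
  refine closure_minimal (fun d hd => ?_) hc this
  refine Submodule.span_induction (p := fun d _ => π d = 0) ?_ (map_zero _)
    (fun a b _ _ ha hb => by rw [map_add, ha, hb, add_zero])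
    (fun k a _ ha => by rw [map_smul, ha, smul_zero]) hd
  rintro _ ⟨b, c, rfl⟩
  have := (indRep_eq_zero_iff hh (lip b b)).1 (h0 _) c c
  rw [lip_lact_eq, ip_ract, ← star_ip b c, map_mul, map_star] at this
  exact CStarRing.star_mul_self_eq_zero_iff _ |>.1 this

/-- A vector which an irreducible representation does not annihilate is cyclic. -/
theorem denseRange_of_irreducible {A : Type*} [NonUnitalCStarAlgebra A]
    {π : A →⋆ₙₐ[ℂ] (H →L[ℂ] H)}
    (hπ : ∀ K : Submodule ℂ H, IsClosed (K : Set H) → (∀ d, ∀ v ∈ K, π d v ∈ K) → K = ⊥ ∨ K = ⊤)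
    {h : H} {d : A} (hd : π d h ≠ 0) : DenseRange fun d => π d h := by
  let L : A →ₗ[ℂ] H :=
    { toFun := fun d => π d h
      map_add' := fun a b => by rw [map_add, _root_.add_apply]
      map_smul' := fun k a => by rw [map_smul, _root_.smul_apply, RingHom.id_apply] }
  have hinv : ∀ a, ∀ v ∈ L.range.topologicalClosure, π a v ∈ L.range.topologicalClosure := by
    intro a v hv
    refine map_mem_closure (π a).continuous hv ?_
    rintro _ ⟨b, rfl⟩
    exact ⟨a * b, by simp [L]⟩
  rcases hπ _ (Submodule.isClosed_topologicalClosure _) hinv with h0 | h0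
  · refine absurd ?_ hd
    rw [← Submodule.mem_bot ℂ, ← h0]
    exact Submodule.le_topologicalClosure _ ⟨d, rfl⟩
  · have := congrArg (fun K : Submodule ℂ H => (K : Set H)) h0
    rw [Submodule.topologicalClosure_coe, Submodule.top_coe, LinearMap.coe_range] at this
    exact dense_iff_closure_eq.2 this

end FellBundle

namespace FellBundleData

open LCGroupoid Fib
open scoped CStarAlgebra

variable {Ω : FellBundleData} {u : Ω.toLCGroupoid.UnitSpace}

/-- Primitive ideals of `B(u)` as kernels of irreducible representations of the C*-algebra
`Ω.Fib u`. -/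
theorem mem_primFiber_iff {P : Set Ω.T} : P ∈ Ω.PrimFiber u.1 ↔
    ∃ (H : Type) (_ : NormedAddCommGroup H) (_ : InnerProductSpace ℂ H) (_ : CompleteSpace H)
      (π : Ω.Fib u.1 →⋆ₙₐ[ℂ] (H →L[ℂ] H)), (∃ d, π d ≠ 0) ∧
      (∀ K : Submodule ℂ H, IsClosed (K : Set H) → (∀ d, ∀ v ∈ K, π d v ∈ K) → K = ⊥ ∨ K = ⊤) ∧
      P = Fib.val '' {d | π d = 0} := by
  classical
  constructor
  · rintro ⟨-, H, _, _, _, π, ⟨⟨hadd, hsmul, hmul, hstar, -⟩, ⟨d, hd, hd'⟩, hK⟩, rfl⟩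
    let ρ : Ω.Fib u.1 →⋆ₙₐ[ℂ] (H →L[ℂ] H) :=
      { toFun := fun d => π d.1
        map_smul' := fun k d => hsmul k d.1 d.2
        map_zero' := by
          have := hsmul 0 (0 : Ω.Fib u.1).1 (0 : Ω.Fib u.1).2
          rw [zero_smul, ← smul_val, zero_smul] at this
          exact this
        map_add' := fun a b => hadd _ _ a.2 b.2
        map_mul' := fun a b => hmul _ _ a.2 b.2
        map_star' := fun a => hstar _ a.2 }
    refine ⟨H, inferInstance, inferInstance, inferInstance, ρ, ⟨⟨d, hd⟩, hd'⟩,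
      fun K hc hinv => hK K hc fun a ha => hinv ⟨a, ha⟩, ?_⟩
    ext t
    constructor
    · rintro ⟨ht, h0⟩
      exact ⟨⟨t, ht⟩, h0, rfl⟩
    · rintro ⟨a, h0, rfl⟩
      exact ⟨a.2, h0⟩
  · rintro ⟨H, _, _, _, ρ, ⟨d, hd⟩, hK, rfl⟩
    let π : Ω.T → H →L[ℂ] H := fun t => if h : Ω.p t = u.1 then ρ ⟨t, h⟩ else 0
    have hπ : ∀ a : Ω.Fib u.1, π a.1 = ρ a := fun a => dif_pos a.2
    refine ⟨u.2, H, inferInstance, inferInstance, inferInstance, π, ⟨⟨?_, ?_, ?_, ?_, ?_⟩, ⟨d.1, d.2, by rwa [hπ]⟩, ?_⟩, ?_⟩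
    · intro a b ha hb
      rw [hπ ⟨a, ha⟩, hπ ⟨b, hb⟩, ← map_add, ← hπ]; rfl
    · intro k a ha
      rw [hπ ⟨a, ha⟩, ← map_smul, ← hπ]; rfl
    · intro a b ha hb
      have := hπ (⟨a, ha⟩ * ⟨b, hb⟩)
      rwa [map_mul, ContinuousLinearMap.mul_def, ← hπ, ← hπ] at this
    · intro a ha
      have := hπ (star ⟨a, ha⟩)
      rwa [map_star, ContinuousLinearMap.star_eq_adjoint, ← hπ] at this
    · intro a ha
      rw [hπ ⟨a, ha⟩]
      exact NonUnitalStarAlgHom.norm_apply_le ρ ⟨a, ha⟩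
    · exact fun K hc hinv => hK K hc fun a v hv => hπ a ▸ hinv a.1 a.2 v hv
    · ext t
      constructor
      · rintro ⟨a, h0, rfl⟩
        exact ⟨a.2, (hπ a).trans h0⟩
      · rintro ⟨ht, h0⟩
        exact ⟨⟨t, ht⟩, (hπ ⟨t, ht⟩).symm.trans h0, rfl⟩

end FellBundleData

namespace FellBundle

open LCGroupoid FellBundleData FellBundleData.Fib
open scoped CStarAlgebra

variable {Ω : FellBundle} {x : Ω.G}

theorem mem_hIdeal_ker_iff {H : Type} [NormedAddCommGroup H] [InnerProductSpace ℂ H]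
    [CompleteSpace H] (π : Ω.Fib (srcUnit x).1 →⋆ₙₐ[ℂ] (H →L[ℂ] H)) {a : Ω.Fib (rngUnit x).1} :
    a.1 ∈ Ω.hIdeal x (Fib.val '' {d | π d = 0}) ↔ ∀ b c : Ω.Fib x, π (ip b (lact a c)) = 0 := by
  let P : Submodule ℂ (Ω.Fib (srcUnit x).1) :=
    { carrier := {d | π d = 0}
      add_mem' := fun {a b} (ha : π a = 0) (hb : π b = 0) =>
        show π (a + b) = 0 by rw [map_add, ha, hb, add_zero]
      zero_mem' := map_zero π
      smul_mem' := fun k a (ha : π a = 0) => show π (k • a) = 0 by rw [map_smul, ha, smul_zero] }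
  exact mem_hIdeal_iff (P := P) (isClosed_eq (map_continuous π) continuous_const)
    (fun a d (hd : π d = 0) => show π (a * d) = 0 by rw [map_mul, hd, mul_zero])
    (fun a d (hd : π d = 0) => show π (d * a) = 0 by rw [map_mul, hd, zero_mul])

theorem p_of_mem_hIdeal {P : Set Ω.T} (hP : ∀ d ∈ P, Ω.p d = Ω.src x) {t : Ω.T}
    (ht : t ∈ Ω.hIdeal x P) : Ω.p t = Ω.rng x := by
  have := Ω.t2G
  refine ((mem_closedSpan_iff ?_).1 ht).1
  rintro _ ⟨a, b, d, ha, hb, hd, rfl⟩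
  have h1 : Ω.p (Ω.bmul a d) = x := by
    rw [Ω.p_bmul _ _ (by rw [ha, hP d hd, Ω.rng_src]), ha, hP d hd, Ω.gmul_src]
  rw [Ω.p_bmul _ _ (by rw [h1, Ω.p_bstar, hb, Ω.rng_ginv]), h1, Ω.p_bstar, hb, Ω.gmul_ginv]

/-- The Rieffel correspondence maps primitive ideals to primitive ideals. -/
theorem hIdeal_mem_primFiber {P : Set Ω.T} (hP : P ∈ Ω.PrimFiber (Ω.src x)) :
    Ω.hIdeal x P ∈ Ω.PrimFiber (Ω.rng x) := by
  obtain ⟨H, _, _, _, π, ⟨d, hd⟩, hK, rfl⟩ := (mem_primFiber_iff (u := srcUnit x)).1 hP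
  obtain ⟨h, hh⟩ : ∃ h, π d h ≠ 0 := by
    by_contra! h0
    exact hd (ContinuousLinearMap.ext h0)
  have hh := denseRange_of_irreducible hK hh
  refine (mem_primFiber_iff (u := rngUnit x)).2 ⟨Ind π h, inferInstance, inferInstance,
    inferInstance, indRep π h, exists_indRep_ne_zero hh ⟨d, hd⟩, indRep_irreducible hK, ?_⟩
  ext t
  constructor
  · intro ht
    have hp : Ω.p t = Ω.rng x := p_of_mem_hIdeal (by rintro _ ⟨d, -, rfl⟩; exact d.2) ht
    exact ⟨⟨t, hp⟩, (indRep_eq_zero_iff hh _).2 ((mem_hIdeal_ker_iff π (a := ⟨t, hp⟩)).1 ht), rfl⟩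
  · rintro ⟨a, ha, rfl⟩
    exact (mem_hIdeal_ker_iff π).2 ((indRep_eq_zero_iff hh a).1 ha)

end FellBundle

namespace FellBundleData

open LCGroupoid Fib

variable {Ω : FellBundleData} {z : Ω.G}

theorem exists_nhds_add (a b : Ω.Fib z) {U : Set Ω.T} (hU : U ∈ 𝓝 (a + b).1) :
    ∃ V ∈ 𝓝 a.1, ∃ W ∈ 𝓝 b.1, ∀ y, ∀ a' b' : Ω.Fib y, a'.1 ∈ V → b'.1 ∈ W → (a' + b').1 ∈ U := by
  have h := Ω.cont_badd.continuousAt (x := ⟨(a.1, b.1), fibre_eq a b⟩) hU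
  rw [mem_map, nhds_subtype_eq_comap, mem_comap] at h
  obtain ⟨t, ht, hs⟩ := h
  rw [nhds_prod_eq, mem_prod_iff] at ht
  obtain ⟨V, hV, W, hW, h⟩ := ht
  exact ⟨V, hV, W, hW, fun y a' b' ha hb =>
    hs (show (⟨(a'.1, b'.1), fibre_eq a' b'⟩ : {q : Ω.T × Ω.T // Ω.p q.1 = Ω.p q.2}) ∈ _ from
      h ⟨ha, hb⟩)⟩

theorem exists_nhds_smul (k : ℂ) (a : Ω.Fib z) {U : Set Ω.T} (hU : U ∈ 𝓝 (k • a).1) :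
    ∃ V ∈ 𝓝 k, ∃ W ∈ 𝓝 a.1, ∀ y, ∀ k' ∈ V, ∀ a' : Ω.Fib y, a'.1 ∈ W → (k' • a').1 ∈ U := by
  have h := Ω.cont_bsmul.continuousAt (x := (k, a.1)) hU
  rw [mem_map, nhds_prod_eq, mem_prod_iff] at h
  obtain ⟨V, hV, W, hW, h⟩ := h
  exact ⟨V, hV, W, hW, fun y k' hk a' ha => h (show (k', a'.1) ∈ _ from ⟨hk, ha⟩)⟩

theorem exists_nhds_sub (a b : Ω.Fib z) {U : Set Ω.T} (hU : U ∈ 𝓝 (a - b).1) :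
    ∃ V ∈ 𝓝 a.1, ∃ W ∈ 𝓝 b.1, ∀ y, ∀ a' b' : Ω.Fib y, a'.1 ∈ V → b'.1 ∈ W → (a' - b').1 ∈ U := by
  rw [sub_eq_add_neg, ← neg_one_smul ℂ b] at hU
  obtain ⟨V, hV, W, hW, h⟩ := exists_nhds_add _ _ hU
  obtain ⟨S, hS, W', hW', h'⟩ := exists_nhds_smul _ _ hW
  refine ⟨V, hV, W', hW', fun y a' b' ha hb => ?_⟩
  rw [sub_eq_add_neg, ← neg_one_smul ℂ b']
  exact h y _ _ ha (h' y _ (mem_of_mem_nhds hS) _ hb)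

theorem norm_lt_mem_nhds (a : Ω.Fib z) {ε : ℝ} (h : ‖a‖ < ε) : {t | Ω.bnorm t < ε} ∈ 𝓝 a.1 :=
  Ω.usc_bnorm a.1 ε h

/-- Every point of the total space has neighbourhoods which are small in each fibre. -/
theorem exists_thin_nhds (a : Ω.Fib z) {ε : ℝ} (hε : 0 < ε) :
    ∃ V : Set Ω.T, IsOpen V ∧ a.1 ∈ V ∧
      ∀ y, ∀ b b' : Ω.Fib y, b.1 ∈ V → b'.1 ∈ V → ‖b - b'‖ < ε := by
  obtain ⟨V, hV, W, hW, h⟩ := exists_nhds_sub a a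
    (norm_lt_mem_nhds (a - a) (by rwa [sub_self, norm_zero]))
  obtain ⟨S, hS, hS', ha⟩ := mem_nhds_iff.1 (inter_mem hV hW)
  exact ⟨S, hS', ha, fun y b b' hb hb' => h y b b' (hS hb).1 (hS hb').2⟩

theorem exists_fibre_mem (a : Ω.Fib z) {U : Set Ω.T} (hU : U ∈ 𝓝 a.1) :
    ∀ᶠ y in 𝓝 z, ∃ b : Ω.Fib y, b.1 ∈ U := by
  have := Ω.p_open.image_mem_nhds hU
  rw [a.2] at this
  filter_upwards [this] with y hy
  obtain ⟨b, hb, h⟩ := hy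
  exact ⟨⟨b, h⟩, hb⟩

/-- The section `σ` is approximately continuous at `z`, up to an error `c`. -/
def Osc (σ : ∀ y, Ω.Fib y) (z : Ω.G) (c : ℝ) : Prop :=
  ∀ η > c, ∀ U ∈ 𝓝 (σ z).1, ∀ᶠ y in 𝓝 z, ∃ b : Ω.Fib y, b.1 ∈ U ∧ ‖b - σ y‖ < η

namespace Osc

variable {σ τ : ∀ y, Ω.Fib y} {c c' : ℝ}

theorem mono (h : Osc σ z c) (hc : c ≤ c') : Osc σ z c' := fun η hη => h η (hc.trans_lt hη)

theorem add (h : Osc σ z c) (h' : Osc τ z c') : Osc (fun y => σ y + τ y) z (c + c') := by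
  intro η hη U hU
  obtain ⟨V, hV, W, hW, hVW⟩ := exists_nhds_add _ _ hU
  have hd : 0 < (η - (c + c')) / 2 := by linarith
  filter_upwards [h (c + (η - (c + c')) / 2) (by linarith) V hV,
    h' (c' + (η - (c + c')) / 2) (by linarith) W hW] with y ⟨a, ha, ha'⟩ ⟨b, hb, hb'⟩
  refine ⟨a + b, hVW y a b ha hb, ?_⟩
  rw [add_sub_add_comm]
  exact (norm_add_le _ _).trans_lt (by linarith)

theorem smul (h : Osc σ z c) {f : Ω.G → ℂ} (hf : ContinuousAt f z) :
    Osc (fun y => f y • σ y) z (‖f z‖ * c) := by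
  intro η hη U hU
  obtain ⟨V, hV, W, hW, hVW⟩ := exists_nhds_smul _ _ hU
  obtain ⟨δ, hδ, hδ'⟩ : ∃ δ > 0, (‖f z‖ + δ) * (c + δ) < η := by
    have : Tendsto (fun δ : ℝ => (‖f z‖ + δ) * (c + δ)) (𝓝[>] 0) (𝓝 ((‖f z‖ + 0) * (c + 0))) :=
      (Continuous.tendsto (by fun_prop) 0).mono_left inf_le_left
    have h1 := this.eventually_lt_const (show _ < η by simpa using hη)
    obtain ⟨δ, h1, h2⟩ := (h1.and self_mem_nhdsWithin).exists
    exact ⟨δ, h2, h1⟩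
  have hn : ∀ᶠ y in 𝓝 z, ‖f y‖ < ‖f z‖ + δ := hf.norm.eventually_lt_const (by linarith)
  filter_upwards [h (c + δ) (by linarith) W hW, hf.eventually_mem hV, hn] with y ⟨b, hb, hb'⟩ hV hn
  refine ⟨f y • b, hVW y _ hV b hb, ?_⟩
  rw [← smul_sub, norm_smul]
  refine lt_of_le_of_lt ?_ hδ'
  gcongr

theorem of_eventually_zero (h : ∀ᶠ y in 𝓝 z, σ y = 0) : Osc σ z 0 := by
  intro η hη U hU
  rw [h.self_of_nhds, zero_val] at hU
  filter_upwards [h, Ω.cont_bzero.continuousAt hU] with y hy hU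
  exact ⟨0, hU, by rwa [hy, sub_self, norm_zero]⟩

theorem sum {ι : Type*} (s : Finset ι) {ψ : ι → ∀ y, Ω.Fib y} {c : ι → ℝ}
    (h : ∀ i ∈ s, Osc (ψ i) z (c i)) : Osc (fun y => ∑ i ∈ s, ψ i y) z (∑ i ∈ s, c i) := by
  classical
  induction s using Finset.induction_on with
  | empty => exact of_eventually_zero (Eventually.of_forall fun y => Finset.sum_empty)
  | insert i s hi ih =>
    simp only [Finset.sum_insert hi]
    exact (h i (Finset.mem_insert_self i s)).add
      (ih fun j hj => h j (Finset.mem_insert_of_mem hj))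

theorem of_norm_le {δ : ℝ} (h : ∀ᶠ y in 𝓝 z, ‖σ y‖ ≤ δ) : Osc σ z (2 * δ) := by
  intro η hη U hU
  have : {t | Ω.bnorm t < η - δ} ∈ 𝓝 (σ z).1 :=
    norm_lt_mem_nhds _ (by have := h.self_of_nhds; linarith)
  filter_upwards [h, exists_fibre_mem _ (inter_mem hU this)] with y hy ⟨b, hb, hb'⟩
  refine ⟨b, hb, (norm_sub_le _ _).trans_lt ?_⟩
  have : ‖b‖ < η - δ := hb'
  linarith

theorem of_thin {V : Set Ω.T} (hV : IsOpen V)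
    (hV' : ∀ y, ∀ b b' : Ω.Fib y, b.1 ∈ V → b'.1 ∈ V → ‖b - b'‖ < c)
    (h : ∀ᶠ y in 𝓝 z, (σ y).1 ∈ V) : Osc σ z c := by
  intro η hη U hU
  filter_upwards [h, exists_fibre_mem _ (inter_mem hU (hV.mem_nhds h.self_of_nhds))]
    with y hy ⟨b, hb, hb'⟩
  exact ⟨b, hb, (hV' y b _ hb' hy).trans hη⟩

/-- A section which is approximately continuous with arbitrarily small error is continuous. -/
theorem continuousAt (h : Osc σ z 0) : ContinuousAt (fun y => (σ y).1) z := by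
  intro U hU
  replace hU : U ∈ 𝓝 (σ z + 0).1 := by rwa [add_zero]
  obtain ⟨V, hV, W, hW, hVW⟩ := exists_nhds_add _ _ hU
  obtain ⟨S, hS, ε, hε, hSW⟩ := Ω.zero_nbhd z W hW
  rw [mem_map]
  filter_upwards [h ε hε V hV, hS] with y ⟨b, hb, hb'⟩ hy
  have : (b + (σ y - b)).1 ∈ U := by
    refine hVW y _ _ hb (hSW _ (by rwa [(σ y - b).2]) ?_)
    rwa [← norm_def, norm_sub_rev]
  rwa [add_sub_cancel] at this

end Osc

/-- An approximately continuous section on a compact set can be replaced by a section with a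
smaller error. -/
theorem exists_osc_lt [T2Space Ω.G] [LocallyCompactSpace Ω.G] {K : Set Ω.G} (hK : IsCompact K)
    {σ : ∀ y, Ω.Fib y} {ε ε' η : ℝ} (hσ : ∀ z ∈ K, Osc σ z ε) (hε' : 0 < ε') (hη : ε < η) :
    ∃ τ : ∀ y, Ω.Fib y, (∀ z ∈ K, Osc τ z ε') ∧ ∀ y ∈ K, ‖τ y - σ y‖ ≤ η := by
  classical
  have loc : ∀ z, ∃ W : Set Ω.G, ∃ ψ : ∀ y, Ω.Fib y, z ∈ K → IsOpen W ∧ z ∈ W ∧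
      (∀ y ∈ W, Osc ψ y ε') ∧ ∀ y ∈ W, ‖ψ y - σ y‖ < η := by
    intro z
    by_cases hz : z ∈ K
    · obtain ⟨V, hV, hz', hV'⟩ := exists_thin_nhds (σ z) hε'
      obtain ⟨W, hW, hWo, hzW⟩ := eventually_nhds_iff.1 (hσ z hz η hη V (hV.mem_nhds hz'))
      choose! ψ h1 h2 using hW
      exact ⟨W, ψ, fun _ => ⟨hWo, hzW, fun y hy => Osc.of_thin hV hV'
        ((hWo.eventually_mem hy).mono h1), h2⟩⟩
    · exact ⟨∅, σ, fun h => absurd h hz⟩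
  choose W ψ hWψ using loc
  obtain ⟨t, htK, ht⟩ := hK.elim_nhds_subcover W fun z hz =>
    (hWψ z hz).1.mem_nhds (hWψ z hz).2.1
  obtain ⟨f, hf, -⟩ := PartitionOfUnity.exists_isSubordinate_of_locallyFinite_t2space (ι := t)
    hK (fun i => W i) (fun i => (hWψ i (htK i i.2)).1) (locallyFinite_of_finite _) fun y hy => by
      obtain ⟨z, hz, hy⟩ := Set.mem_iUnion₂.1 (ht hy)
      exact Set.mem_iUnion.2 ⟨⟨z, hz⟩, hy⟩
  have hsum : ∀ y ∈ K, ∑ i, f i y = 1 := fun y hy => by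
    rw [← finsum_eq_sum_of_fintype]; exact f.sum_eq_one hy
  have hn : ∀ i y, ‖((f i y : ℝ) : ℂ)‖ = f i y := fun i y => by
    rw [Complex.norm_real, Real.norm_of_nonneg (f.nonneg i y)]
  refine ⟨fun y => ∑ i, ((f i y : ℝ) : ℂ) • ψ i y, fun z hz => ?_, fun y hy => ?_⟩
  · have key : ∀ i ∈ Finset.univ, Osc (fun y => ((f i y : ℝ) : ℂ) • ψ i y) z (f i z * ε') := by
      intro i _
      by_cases hi : z ∈ tsupport (f i)
      · rw [← hn]
        exact ((hWψ i (htK i i.2)).2.2.1 z (hf i hi)).smul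
          (Complex.continuous_ofReal.comp (f i).continuous).continuousAt
      · have := notMem_tsupport_iff_eventuallyEq.1 hi
        refine (Osc.of_eventually_zero ?_).mono (mul_nonneg (f.nonneg i z) hε'.le)
        filter_upwards [this] with y hy
        rw [hy]; simp
    refine (Osc.sum Finset.univ key).mono ?_
    rw [← Finset.sum_mul, hsum z hz, one_mul]
  · have e : ∑ i, ((f i y : ℝ) : ℂ) • ψ i y - σ y = ∑ i, ((f i y : ℝ) : ℂ) • (ψ i y - σ y) := by
      simp only [smul_sub, Finset.sum_sub_distrib, ← Finset.sum_smul, ← Complex.ofReal_sum]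
      rw [hsum y hy, Complex.ofReal_one, one_smul]
    rw [e]
    calc _ ≤ ∑ i, f i y * η := by
          refine norm_sum_le_of_le _ fun i _ => ?_
          rw [norm_smul, hn]
          by_cases hi : y ∈ tsupport (f i)
          · exact mul_le_mul_of_nonneg_left ((hWψ i (htK i i.2)).2.2.2 y (hf i hi)).le
              (f.nonneg i y)
          · rw [image_eq_zero_of_notMem_tsupport hi, zero_mul, zero_mul]
      _ = η := by rw [← Finset.sum_mul, hsum y hy, one_mul]

end FellBundleData

namespace FellBundleData

open LCGroupoid Fib

variable {Ω : FellBundleData}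

theorem Osc.of_forall_pos {z : Ω.G} {σ : ∀ y, Ω.Fib y}
    (h : ∀ c > 0, Osc σ z c) : Osc σ z 0 :=
  fun η hη => h (η / 2) (half_pos hη) η (half_lt_self hη)

/-- Near a point of the total space there are sections which are continuous on a compact set. -/
theorem exists_osc_zero [T2Space Ω.G] [LocallyCompactSpace Ω.G] {x : Ω.G} (a : Ω.Fib x) {ε : ℝ}
    (hε : 0 < ε) : ∃ σ : ∀ y, Ω.Fib y, (∀ᶠ z in 𝓝 x, Osc σ z 0) ∧ ‖σ x - a‖ ≤ ε := by
  classical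
  set e : ℝ := ε / 4 with he
  have he0 : 0 < e := by positivity
  obtain ⟨V, hV, ha, hV'⟩ := exists_thin_nhds a he0
  have hex : ∀ y, ∃ b : Ω.Fib y, (∃ c : Ω.Fib y, c.1 ∈ V) → b.1 ∈ V := by
    intro y
    by_cases h : ∃ c : Ω.Fib y, c.1 ∈ V
    · exact ⟨h.choose, fun _ => h.choose_spec⟩
    · exact ⟨0, fun h' => absurd h' h⟩
  choose σ' hσ' using hex
  set σ₀ : ∀ y, Ω.Fib y := Function.update σ' x a with hσ₀
  have hσ₀V : ∀ᶠ y in 𝓝 x, (σ₀ y).1 ∈ V := by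
    filter_upwards [exists_fibre_mem a (hV.mem_nhds ha)] with y hy
    by_cases h : y = x
    · subst h; rwa [hσ₀, Function.update_self]
    · rw [hσ₀, Function.update_of_ne h]; exact hσ' y hy
  obtain ⟨W, hW, hWo, hxW⟩ := eventually_nhds_iff.1 hσ₀V
  obtain ⟨K, hK, hxK, hKW⟩ := exists_compact_subset hWo hxW
  have h0 : ∀ z ∈ K, Osc σ₀ z (e / 2 ^ 0) := fun z hz => by
    rw [pow_zero, div_one]
    exact Osc.of_thin hV hV' ((hWo.eventually_mem (hKW hz)).mono hW)
  have step : ∀ (n : ℕ) (σ : ∀ y, Ω.Fib y), (∀ z ∈ K, Osc σ z (e / 2 ^ n)) →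
      ∃ τ : ∀ y, Ω.Fib y, (∀ z ∈ K, Osc τ z (e / 2 ^ (n + 1))) ∧
        ∀ y ∈ K, ‖τ y - σ y‖ ≤ ε / 2 / 2 ^ n := fun n σ h =>
    exists_osc_lt hK h (by positivity) (by rw [he]; gcongr; linarith)
  choose! F hF1 hF2 using step
  let s : ℕ → ∀ y, Ω.Fib y := fun n => Nat.rec σ₀ (fun n σ => F n σ) n
  have hs : ∀ n, ∀ z ∈ K, Osc (s n) z (e / 2 ^ n) := by
    intro n
    induction n with
    | zero => exact h0
    | succ n ih => exact hF1 n _ ih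
  have hd : ∀ y ∈ K, ∀ n, dist (s n y) (s (n + 1) y) ≤ ε / 2 / 2 ^ n := fun y hy n => by
    rw [dist_comm, dist_eq_norm]
    exact hF2 n _ (hs n) y hy
  have hlim : ∀ y, ∃ b : Ω.Fib y, y ∈ K → Tendsto (fun n => s n y) atTop (𝓝 b) := by
    intro y
    by_cases hy : y ∈ K
    · obtain ⟨b, hb⟩ := cauchySeq_tendsto_of_complete (cauchySeq_of_le_geometric_two (hd y hy))
      exact ⟨b, fun _ => hb⟩
    · exact ⟨0, fun h => absurd h hy⟩
  choose σ hσ using hlim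
  have hdist : ∀ y ∈ K, ∀ n, ‖σ y - s n y‖ ≤ ε / 2 ^ n := fun y hy n => by
    rw [← dist_eq_norm, dist_comm]
    exact dist_le_of_le_geometric_two_of_tendsto (hd y hy) (hσ y hy) n
  refine ⟨σ, ?_, ?_⟩
  · filter_upwards [isOpen_interior.mem_nhds hxK] with z hz
    refine Osc.of_forall_pos fun c hc => ?_
    have hlim : Tendsto (fun n : ℕ => e / 2 ^ n + 2 * (ε / 2 ^ n)) atTop (𝓝 0) := by
      have h2 : Tendsto (fun n : ℕ => ((1 : ℝ) / 2) ^ n) atTop (𝓝 0) :=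
        tendsto_pow_atTop_nhds_zero_of_lt_one (by norm_num) (by norm_num)
      have := h2.const_mul (e + 2 * ε)
      rw [mul_zero] at this
      refine this.congr fun n => ?_
      rw [one_div, inv_pow]; ring
    obtain ⟨n, hn⟩ := (hlim.eventually_lt_const hc).exists
    have := (hs n z (interior_subset hz)).add (τ := fun y => σ y - s n y)
      (Osc.of_norm_le (δ := ε / 2 ^ n) ((isOpen_interior.eventually_mem hz).mono fun y hy =>
        hdist y (interior_subset hy) n))
    simp only [add_sub_cancel] at this
    exact this.mono hn.le
  · have := hdist x (interior_subset hxK) 0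
    rw [pow_zero, div_one] at this
    have e : s 0 x = a := Function.update_self x a σ'
    rwa [e] at this

/-- A Fell bundle has enough continuous sections of compact support. -/
theorem exists_section [T2Space Ω.G] [LocallyCompactSpace Ω.G] {x : Ω.G} (a : Ω.Fib x) {ε : ℝ}
    (hε : 0 < ε) : ∃ σ : ∀ y, Ω.Fib y, Continuous (fun y => (σ y).1) ∧
      (∃ K : Set Ω.G, IsCompact K ∧ ∀ y ∉ K, σ y = 0) ∧ ‖σ x - a‖ ≤ ε := by
  obtain ⟨σ, hσ, hx⟩ := exists_osc_zero a hε
  obtain ⟨W, hW, hWo, hxW⟩ := eventually_nhds_iff.1 hσ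
  obtain ⟨f, hf1, hfc, hfW, -⟩ := exists_continuousMap_one_of_isCompact_subset_isOpen
    (isCompact_singleton (x := x)) hWo (Set.singleton_subset_iff.2 hxW)
  refine ⟨fun y => ((f y : ℝ) : ℂ) • σ y, continuous_iff_continuousAt.2 fun z => ?_,
    ⟨tsupport f, hfc, fun y hy => ?_⟩, ?_⟩
  · refine Osc.continuousAt ?_
    by_cases hz : z ∈ tsupport f
    · have := (hW z (hfW hz)).smul
        (Complex.continuous_ofReal.comp f.continuous).continuousAt
      rwa [mul_zero] at this
    · refine Osc.of_eventually_zero ?_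
      filter_upwards [notMem_tsupport_iff_eventuallyEq.1 hz] with y hy
      rw [hy]; simp
  · change ((f y : ℝ) : ℂ) • σ y = 0
    rw [image_eq_zero_of_notMem_tsupport hy]; simp
  · have : f x = 1 := hf1 rfl
    change ‖((f x : ℝ) : ℂ) • σ x - a‖ ≤ ε
    rwa [this, Complex.ofReal_one, one_smul]

/-- The sections in `A = Γ₀(G⁰; B)` take a dense set of values in each fibre. -/
theorem exists_isA [T2Space Ω.G] [LocallyCompactSpace Ω.G] {u : Ω.toLCGroupoid.UnitSpace}
    (a : Ω.Fib u.1) {ε : ℝ} (hε : 0 < ε) :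
    ∃ σ : ∀ v : Ω.toLCGroupoid.UnitSpace, Ω.Fib v.1, Ω.IsA (fun v => (σ v).1) ∧
      ‖σ u - a‖ ≤ ε := by
  obtain ⟨σ, hσ, ⟨K, hK, h0⟩, h⟩ := exists_section a hε
  have hc : Topology.IsClosedEmbedding (Subtype.val : Ω.toLCGroupoid.UnitSpace → Ω.G) :=
    (isClosed_eq continuous_rng continuous_id).isClosedEmbedding_subtypeVal
  refine ⟨fun v => σ v.1, ⟨fun v => (σ v.1).2, hσ.comp continuous_subtype_val, fun ε hε =>
    ⟨_, hc.isCompact_preimage hK, fun v hv => ?_⟩⟩, h⟩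
  change ‖σ v.1‖ < ε
  rw [h0 v.1 hv, norm_zero]
  exact hε

end FellBundleData

section SoftThreshold

open scoped CStarAlgebra

/-- In a C*-algebra there is an element whose image under a `*`-homomorphism vanishes exactly
when the image of `a` is small. -/
theorem exists_map_eq_zero_iff_norm_sq_le {A : Type} [NonUnitalCStarAlgebra A] (a : A) {e : ℝ}
    (he : 0 < e) : ∃ g : A, ∀ (B : Type) [NonUnitalCStarAlgebra B] (φ : A →⋆ₙₐ[ℂ] B),
      φ g = 0 ↔ ‖φ a‖ ^ 2 ≤ e := by
  let f : ℝ → ℝ := fun t => max (-e) (min e t)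
  have hf : Continuous f := by fun_prop
  have hf0 : f 0 = 0 := by simp [f, he.le]
  have hsa : IsSelfAdjoint (star a * a) := .star_mul_self a
  refine ⟨star a * a - cfcₙ f (star a * a), fun B _ φ => ?_⟩
  have hφ : φ (star a * a) = star (φ a) * φ a := by rw [map_mul, map_star]
  have hsb : IsSelfAdjoint (star (φ a) * φ a) := .star_mul_self _
  have hmap : φ (cfcₙ f (star a * a)) = cfcₙ f (star (φ a) * φ a) := by
    rw [← hφ]
    exact NonUnitalStarAlgHomClass.map_cfcₙ (R := ℝ) (S := ℂ) φ f (star a * a) hf.continuousOn hf0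
      (map_continuous φ) hsa (hφ ▸ hsb)
  rw [map_sub, hφ, hmap, sub_eq_zero, sq, ← CStarRing.norm_star_mul_self]
  constructor
  · intro h
    rw [h]
    refine norm_cfcₙ_le fun t _ => ?_
    rw [Real.norm_eq_abs, abs_le]
    exact ⟨le_max_left _ _, max_le (by linarith) (min_le_left _ _)⟩
  · intro h
    conv_lhs => rw [← cfcₙ_id ℝ (star (φ a) * φ a)]
    refine cfcₙ_congr fun t ht => ?_
    have := (NonUnitalIsometricContinuousFunctionalCalculus.norm_quasispectrum_le
      (star (φ a) * φ a) ht).trans h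
    rw [Real.norm_eq_abs, abs_le] at this
    simp only [id, f]
    rw [min_eq_right this.2, max_eq_right this.1]

end SoftThreshold

namespace FellBundleData

open LCGroupoid Fib
open scoped ENNReal

variable {Ω : FellBundleData}

theorem IsA.add {σ τ : Ω.toLCGroupoid.UnitSpace → Ω.T} (hσ : Ω.IsA σ) (hτ : Ω.IsA τ) :
    Ω.IsA fun u => Ω.badd (σ u) (τ u) := by
  have hp : ∀ u, Ω.p (σ u) = Ω.p (τ u) := fun u => (hσ.1 u).trans (hτ.1 u).symm
  refine ⟨fun u => (Ω.p_badd _ _ (hp u)).trans (hσ.1 u), continuous_badd hσ.2.1 hτ.2.1 hp,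
    fun ε hε => ?_⟩
  obtain ⟨K, hK, h⟩ := hσ.2.2 (ε / 2) (half_pos hε)
  obtain ⟨L, hL, h'⟩ := hτ.2.2 (ε / 2) (half_pos hε)
  refine ⟨K ∪ L, hK.union hL, fun u hu => ?_⟩
  rw [Set.mem_union, not_or] at hu
  have := Ω.bnorm_badd_le _ _ (hp u)
  have := h u hu.1
  have := h' u hu.2
  linarith

theorem IsA.smul (c : ℂ) {σ : Ω.toLCGroupoid.UnitSpace → Ω.T} (hσ : Ω.IsA σ) :
    Ω.IsA fun u => Ω.bsmul c (σ u) := by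
  refine ⟨fun u => (Ω.p_bsmul _ _).trans (hσ.1 u), continuous_bsmul continuous_const hσ.2.1,
    fun ε hε => ?_⟩
  obtain ⟨K, hK, h⟩ := hσ.2.2 (ε / (‖c‖ + 1)) (by positivity)
  refine ⟨K, hK, fun u hu => ?_⟩
  rw [Ω.bnorm_bsmul]
  have h1 := h u hu
  have h2 := Ω.bnorm_nonneg (σ u)
  rw [lt_div_iff₀ (by positivity)] at h1
  linarith

theorem IsA.zero : Ω.IsA fun u => Ω.bzero u.1 :=
  ⟨fun u => Ω.p_bzero _, Ω.cont_bzero.comp continuous_subtype_val, fun ε hε =>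
    ⟨∅, isCompact_empty, fun u _ => by
      change ‖(0 : Ω.Fib u.1)‖ < ε
      rwa [norm_zero]⟩⟩

theorem IsA.bstar {σ : ∀ u : Ω.toLCGroupoid.UnitSpace, Ω.Fib u.1} (hσ : Ω.IsA fun u => (σ u).1) :
    Ω.IsA fun u => Ω.bstar (σ u).1 := by
  refine ⟨fun u => (star (σ u)).2, Ω.cont_bstar.comp hσ.2.1, fun ε hε => ?_⟩
  obtain ⟨K, hK, h⟩ := hσ.2.2 ε hε
  refine ⟨K, hK, fun u hu => ?_⟩
  have := h u hu
  rw [← norm_def, ← norm_star] at this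
  exact this

theorem IsA.bddAbove {σ : Ω.toLCGroupoid.UnitSpace → Ω.T} (hσ : Ω.IsA σ) :
    BddAbove (Set.range fun u => Ω.bnorm (σ u)) := by
  obtain ⟨K, hK, h⟩ := hσ.2.2 1 one_pos
  obtain ⟨C, hC⟩ := ((Ω.usc_bnorm.comp hσ.2.1).upperSemicontinuousOn K).bddAbove_of_isCompact hK
  refine ⟨max C 1, ?_⟩
  rintro _ ⟨u, rfl⟩
  by_cases hu : u ∈ K
  · exact le_max_of_le_left (hC ⟨u, hu, rfl⟩)
  · exact le_max_of_le_right (h u hu).le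

theorem IsA.mul {σ τ : ∀ u : Ω.toLCGroupoid.UnitSpace, Ω.Fib u.1} (hσ : Ω.IsA fun u => (σ u).1)
    (hτ : Ω.IsA fun u => (τ u).1) : Ω.IsA fun u => (σ u * τ u).1 := by
  refine ⟨fun u => (σ u * τ u).2, continuous_bmul hσ.2.1 hτ.2.1 fun u => composable _ _,
    fun ε hε => ?_⟩
  obtain ⟨C, hC⟩ := hτ.bddAbove
  obtain ⟨K, hK, h⟩ := hσ.2.2 (ε / (max C 0 + 1)) (by positivity)
  refine ⟨K, hK, fun u hu => ?_⟩
  have h1 : ‖σ u‖ < ε / (max C 0 + 1) := h u hu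
  have h2 : ‖τ u‖ ≤ max C 0 := (hC ⟨u, rfl⟩).trans (le_max_left _ _)
  rw [lt_div_iff₀ (by positivity)] at h1
  change ‖σ u * τ u‖ < ε
  have h3 := norm_nonneg (σ u)
  nlinarith [norm_mul_le (σ u) (τ u)]

/-- `Γ₀(G⁰; B)` is closed under uniform limits. -/
theorem IsA.of_forall_exists_norm_sub_lt {σ : ∀ u : Ω.toLCGroupoid.UnitSpace, Ω.Fib u.1}
    (h : ∀ ε > 0, ∃ τ : ∀ u : Ω.toLCGroupoid.UnitSpace, Ω.Fib u.1, Ω.IsA (fun u => (τ u).1) ∧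
      ∀ u, ‖σ u - τ u‖ < ε) : Ω.IsA fun u => (σ u).1 := by
  refine ⟨fun u => (σ u).2, continuous_iff_continuousAt.2 fun z U hU => ?_, fun ε hε => ?_⟩
  · replace hU : U ∈ 𝓝 (σ z + 0).1 := by rwa [add_zero]
    obtain ⟨V, hV, W, hW, hVW⟩ := exists_nhds_add _ _ hU
    obtain ⟨S, hS, ε, hε, hSW⟩ := Ω.zero_nbhd z.1 W hW
    obtain ⟨V', hV', hVo, hz⟩ := mem_nhds_iff.1 hV
    obtain ⟨ε', hε', hVn⟩ := Ω.norm_nbhd_fiber _ V' (hVo.mem_nhds hz)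
    obtain ⟨τ, hτ, hτ'⟩ := h (min ε ε') (lt_min hε hε')
    have h1 : (τ z).1 ∈ V' := hVn _ (fibre_eq _ _) (by
      rw [← norm_sub_def, norm_sub_rev]
      exact (hτ' z).trans_le (min_le_right _ _))
    rw [mem_map]
    filter_upwards [hτ.2.1.continuousAt (hVo.mem_nhds h1), continuous_subtype_val.continuousAt hS]
      with y hy hy'
    have : (τ y + (σ y - τ y)).1 ∈ U := by
      refine hVW y.1 _ _ (hV' hy) (hSW _ ?_ ?_)
      · rw [(σ y - τ y).2]; exact hy'
      · rw [← norm_def]; exact (hτ' y).trans_le (min_le_left _ _)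
    rwa [add_sub_cancel] at this
  · obtain ⟨τ, hτ, hτ'⟩ := h (ε / 2) (half_pos hε)
    obtain ⟨K, hK, h⟩ := hτ.2.2 (ε / 2) (half_pos hε)
    refine ⟨K, hK, fun u hu => ?_⟩
    have h1 : ‖τ u‖ < ε / 2 := h u hu
    change ‖σ u‖ < ε
    have h2 := hτ' u
    have h3 := norm_le_norm_add_norm_sub' (σ u) (τ u)
    linarith

variable (Ω) in
/-- The C*-algebra `Γ₀(G⁰; B)`, as a subalgebra of the bounded sections. -/
def secAlg : NonUnitalStarSubalgebra ℂ
    (lp (fun u : Ω.toLCGroupoid.UnitSpace => Ω.Fib u.1) ∞) where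
  carrier := {f | Ω.IsA fun u => (f u).1}
  add_mem' hf hg := IsA.add hf hg
  zero_mem' := IsA.zero
  mul_mem' hf hg := IsA.mul hf hg
  smul_mem' c _ hf := IsA.smul c hf
  star_mem' hf := IsA.bstar hf

instance : IsClosed (Ω.secAlg : Set (lp (fun u : Ω.toLCGroupoid.UnitSpace => Ω.Fib u.1) ∞)) := by
  refine isClosed_of_closure_subset fun f hf => IsA.of_forall_exists_norm_sub_lt fun ε hε => ?_
  obtain ⟨g, hg, h⟩ := Metric.mem_closure_iff.1 hf ε hε
  rw [dist_eq_norm] at h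
  exact ⟨g, hg, fun u => (lp.norm_apply_le_norm ENNReal.top_ne_zero (f - g) u).trans_lt h⟩

variable (Ω) in
/-- The C*-algebra `Γ₀(G⁰; B)`. -/
def SecAlg : Type := Ω.secAlg

instance : NonUnitalCStarAlgebra Ω.SecAlg :=
  NonUnitalStarSubalgebra.nonUnitalCStarAlgebra Ω.secAlg

/-- Evaluation of sections at a unit. -/
def secEval (u : Ω.toLCGroupoid.UnitSpace) : Ω.SecAlg →⋆ₙₐ[ℂ] Ω.Fib u.1 where
  toFun f := f.1 u
  map_smul' _ _ := rfl
  map_zero' := rfl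
  map_add' _ _ := rfl
  map_mul' _ _ := rfl
  map_star' _ := rfl

/-- For `a ∈ A` and `e > 0` there is `g ∈ A` such that `g(u) ∈ ker π` iff `‖π(a(u))‖² ≤ e`. -/
theorem exists_isA_apply_eq_zero_iff {σ : ∀ u : Ω.toLCGroupoid.UnitSpace, Ω.Fib u.1}
    (hσ : Ω.IsA fun u => (σ u).1) {e : ℝ} (he : 0 < e) :
    ∃ g : ∀ u : Ω.toLCGroupoid.UnitSpace, Ω.Fib u.1, Ω.IsA (fun u => (g u).1) ∧
      ∀ (u : Ω.toLCGroupoid.UnitSpace) (B : Type) [NonUnitalCStarAlgebra B]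
        (π : Ω.Fib u.1 →⋆ₙₐ[ℂ] B), π (g u) = 0 ↔ ‖π (σ u)‖ ^ 2 ≤ e := by
  obtain ⟨g, hg⟩ := exists_map_eq_zero_iff_norm_sq_le (A := Ω.SecAlg)
    (⟨⟨σ, memℓp_infty hσ.bddAbove⟩, hσ⟩ : Ω.SecAlg) he
  exact ⟨fun u => g.1 u, g.2, fun u B _ π => hg B (π.comp (secEval u))⟩

/-- The open subset of `Prim A` on which a given section does not vanish. -/
theorem isOpen_hullKernelTop_notMem {g : ∀ u : Ω.toLCGroupoid.UnitSpace, Ω.Fib u.1}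
    (hg : Ω.IsA fun u => (g u).1) : IsOpen[Ω.hullKernelTop]
      {q : Ω.PrimPair | ∀ h : Ω.rng q.1.1 = q.1.1, (g ⟨q.1.1, h⟩).1 ∉ q.1.2} := by
  let S : Set (Ω.toLCGroupoid.UnitSpace → Ω.T) := {τ | Ω.IsA τ ∧
    ∀ (u : Ω.toLCGroupoid.UnitSpace), ∀ P ∈ Ω.PrimFiber u.1, (g u).1 ∈ P → τ u ∈ P}
  have mem : ∀ {H : Type} [NormedAddCommGroup H] [InnerProductSpace ℂ H] [CompleteSpace H]
      {u : Ω.toLCGroupoid.UnitSpace} (π : Ω.Fib u.1 →⋆ₙₐ[ℂ] (H →L[ℂ] H)) {d : Ω.Fib u.1},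
      d.1 ∈ Fib.val '' {d | π d = 0} ↔ π d = 0 := fun π d =>
    ⟨fun ⟨d', h, e⟩ => Fib.ext e ▸ h, fun h => ⟨d, h, rfl⟩⟩
  have hS : Ω.IsIdealA S := by
    refine ⟨fun σ hσ => hσ.1, ⟨IsA.zero, fun u P hP _ => ?_⟩, fun σ hσ τ hτ =>
      ⟨hσ.1.add hτ.1, fun u P hP hgP => ?_⟩, fun c σ hσ => ⟨hσ.1.smul c, fun u P hP hgP => ?_⟩,
      fun σ hσ τ hτ => ⟨⟨?_, fun u P hP hgP => ?_⟩, ⟨?_, fun u P hP hgP => ?_⟩⟩,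
      fun σ hσ happ => ⟨hσ, fun u P hP hgP => ?_⟩⟩
    · obtain ⟨H, _, _, _, π, -, -, rfl⟩ := mem_primFiber_iff.1 hP
      exact (mem π).2 (map_zero π)
    · have h1 := hσ.2 u P hP hgP
      have h2 := hτ.2 u P hP hgP
      obtain ⟨H, _, _, _, π, -, -, rfl⟩ := mem_primFiber_iff.1 hP
      obtain ⟨a, ha, ha'⟩ := h1
      obtain ⟨b, hb, hb'⟩ := h2
      beta_reduce
      rw [← ha', ← hb']
      refine (mem π (d := a + b)).2 ?_
      rw [map_add, show π a = 0 from ha, show π b = 0 from hb, add_zero]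
    · have h1 := hσ.2 u P hP hgP
      obtain ⟨H, _, _, _, π, -, -, rfl⟩ := mem_primFiber_iff.1 hP
      obtain ⟨a, ha, ha'⟩ := h1
      beta_reduce
      rw [← ha']
      refine (mem π (d := c • a)).2 ?_
      rw [map_smul, show π a = 0 from ha, smul_zero]
    · exact IsA.mul (σ := fun u => ⟨σ u, hσ.1.1 u⟩) (τ := fun u => ⟨τ u, hτ.1 u⟩) hσ.1 hτ
    · have h1 := hσ.2 u P hP hgP
      obtain ⟨H, _, _, _, π, -, -, rfl⟩ := mem_primFiber_iff.1 hP
      obtain ⟨a, ha, ha'⟩ := h1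
      beta_reduce
      rw [← ha']
      refine (mem π (d := a * ⟨τ u, hτ.1 u⟩)).2 ?_
      rw [map_mul, show π a = 0 from ha, zero_mul]
    · exact IsA.mul (σ := fun u => ⟨τ u, hτ.1 u⟩) (τ := fun u => ⟨σ u, hσ.1.1 u⟩) hτ hσ.1
    · have h1 := hσ.2 u P hP hgP
      obtain ⟨H, _, _, _, π, -, -, rfl⟩ := mem_primFiber_iff.1 hP
      obtain ⟨a, ha, ha'⟩ := h1
      beta_reduce
      rw [← ha']
      refine (mem π (d := ⟨τ u, hτ.1 u⟩ * a)).2 ?_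
      rw [map_mul, show π a = 0 from ha, mul_zero]
    · have hfib := mem_primFiber_iff.1 hP
      obtain ⟨H, _, _, _, π, -, -, rfl⟩ := hfib
      refine (mem π (d := ⟨σ u, hσ.1 u⟩)).2 (norm_le_zero_iff.1 (le_of_forall_pos_lt_add
        fun ε hε => ?_))
      obtain ⟨τ, hτ, hτ'⟩ := happ ε hε
      obtain ⟨b, hb, hb'⟩ := hτ.2 u _ hP hgP
      have h1 := hτ' u
      rw [← hb', ← norm_sub_def ⟨σ u, hσ.1 u⟩ b] at h1
      have h2 := NonUnitalStarAlgHom.norm_apply_le π (⟨σ u, hσ.1 u⟩ - b)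
      rw [map_sub, show π b = 0 from hb, sub_zero] at h2
      linarith
  refine TopologicalSpace.GenerateOpen.basic _ ⟨S, hS, Set.ext fun q => not_iff_not.1 ?_⟩
  simp only [Set.mem_ofPred_eq, not_not, not_forall]
  constructor
  · rintro ⟨h, hq⟩ _ ⟨τ, hτ, h', rfl⟩
    exact hτ.2 ⟨_, h'⟩ _ q.2 hq
  · intro h
    exact ⟨q.2.1, h ⟨_, ⟨hg, fun u P _ h => h⟩, q.2.1, rfl⟩⟩

end FellBundleData

namespace FellBundleData

open LCGroupoid Fib

variable {Ω : FellBundleData}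

/-- The set of `(b, c)` for which `b* σ(r(x)) c` is close to `a(s(x))` is open in the space of
pairs in a common fibre `B(x)`. -/
theorem exists_nhds_norm_ip_lact_sub_lt {σ a : ∀ u : Ω.toLCGroupoid.UnitSpace, Ω.Fib u.1}
    (hσ : Continuous fun u => (σ u).1) (ha : Continuous fun u => (a u).1) {x : Ω.G}
    (b c : Ω.Fib x) {ε : ℝ} (h : ‖ip b (lact (σ (rngUnit x)) c) - a (srcUnit x)‖ < ε) :
    ∃ W ∈ 𝓝 x, ∀ y ∈ W, ∃ b' c' : Ω.Fib y,
      ‖ip b' (lact (σ (rngUnit y)) c') - a (srcUnit y)‖ < ε := by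
  let Z := {q : Ω.T × Ω.T // Ω.p q.1 = Ω.p q.2}
  have h1 : Continuous fun q : Z => q.1.1 := continuous_fst.comp continuous_subtype_val
  have h2 : Continuous fun q : Z => q.1.2 := continuous_snd.comp continuous_subtype_val
  have h3 : Continuous fun q : Z => Ω.p q.1.2 := Ω.p_cont.comp h2
  have h4 : Continuous fun q : Z => Ω.bmul (σ (rngUnit (Ω.p q.1.2))).1 q.1.2 :=
    continuous_bmul (hσ.comp (continuous_rngUnit.comp h3)) h2 fun q => by
      rw [(σ _).2, rngUnit_val, Ω.src_rng]
  have h5 : Continuous fun q : Z =>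
      Ω.bmul (Ω.bstar q.1.1) (Ω.bmul (σ (rngUnit (Ω.p q.1.2))).1 q.1.2) :=
    continuous_bmul (Ω.cont_bstar.comp h1) h4 fun q => by
      rw [Ω.p_bstar, Ω.src_ginv, q.2]
      exact congrArg Ω.rng (lact (σ (rngUnit (Ω.p q.1.2))) ⟨q.1.2, rfl⟩).2.symm
  have h6 : Continuous fun q : Z =>
      Ω.badd (Ω.bmul (Ω.bstar q.1.1) (Ω.bmul (σ (rngUnit (Ω.p q.1.2))).1 q.1.2))
        (Ω.bsmul (-1) (a (srcUnit (Ω.p q.1.2))).1) :=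
    continuous_badd h5 (continuous_bsmul continuous_const
      (ha.comp (continuous_srcUnit.comp h3))) fun q => by
        rw [Ω.p_bsmul, (a _).2]
        exact (ip ⟨q.1.1, q.2⟩ (lact (σ (rngUnit (Ω.p q.1.2))) ⟨q.1.2, rfl⟩)).2
  have key : ∀ y (b' c' : Ω.Fib y), Ω.bnorm
      (Ω.badd (Ω.bmul (Ω.bstar b'.1) (Ω.bmul (σ (rngUnit (Ω.p c'.1))).1 c'.1))
        (Ω.bsmul (-1) (a (srcUnit (Ω.p c'.1))).1)) =
      ‖ip b' (lact (σ (rngUnit y)) c') - a (srcUnit y)‖ := by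
    rintro y b' ⟨c', rfl⟩
    rw [norm_sub_def]; rfl
  have ev := h6.continuousAt (x := (⟨(b.1, c.1), fibre_eq b c⟩ : Z))
    (Ω.usc_bnorm _ ε ((key x b c).trans_lt h))
  rw [mem_map, nhds_subtype_eq_comap, mem_comap] at ev
  obtain ⟨t, ht, hts⟩ := ev
  rw [nhds_prod_eq, mem_prod_iff] at ht
  obtain ⟨U, hU, V, hV, hUV⟩ := ht
  refine ⟨_, inter_mem (exists_fibre_mem b hU) (exists_fibre_mem c hV), ?_⟩
  rintro y ⟨⟨b', hb'⟩, ⟨c', hc'⟩⟩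
  refine ⟨b', c', ?_⟩
  rw [← key]
  exact hts (show (⟨(b'.1, c'.1), fibre_eq b' c'⟩ : Z) ∈ _ from hUV ⟨hb', hc'⟩)

end FellBundleData

namespace FellBundle

open LCGroupoid FellBundleData Fib

variable {Ω : FellBundle}

theorem isOpen_not_fiberIm_subset_hIdeal [T2Space Ω.G] [LocallyCompactSpace Ω.G]
    {J : Set (Ω.toLCGroupoid.UnitSpace → Ω.T)} (hJ : Ω.toFellBundleData.IsIdealA J) :
    letI : TopologicalSpace Ω.toFellBundleData.PrimPair := Ω.toFellBundleData.hullKernelTop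
    IsOpen {q : {q : Ω.G × Ω.toFellBundleData.PrimPair // Ω.src q.1 = q.2.1.1} |
      ¬ Ω.toFellBundleData.fiberIm J (Ω.rng q.1.1) ⊆
        Ω.toFellBundleData.hIdeal q.1.1 q.1.2.1.2} := by
  let : TopologicalSpace Ω.toFellBundleData.PrimPair := Ω.toFellBundleData.hullKernelTop
  rw [isOpen_iff_mem_nhds]
  rintro ⟨⟨x, ⟨⟨u, P⟩, hP⟩⟩, hx⟩ hq
  change Ω.src x = u at hx
  subst hx
  obtain ⟨_, ⟨τ, hτJ, _, rfl⟩, hτ⟩ := Set.not_subset.1 hq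
  obtain ⟨H, _, _, _, π, -, -, hPπ⟩ := (mem_primFiber_iff (u := srcUnit x)).1 hP
  change P = _ at hPπ
  have hτA := hJ.1 τ hτJ
  let σ : ∀ u : Ω.toLCGroupoid.UnitSpace, Ω.Fib u.1 := fun u => ⟨τ u, hτA.1 u⟩
  obtain ⟨b, c, hbc⟩ : ∃ b c, π (ip b (lact (σ (rngUnit x)) c)) ≠ 0 := by
    by_contra! h
    apply hτ
    change (σ (rngUnit x)).1 ∈ Ω.toFellBundleData.hIdeal x P
    rw [hPπ]
    exact (mem_hIdeal_ker_iff π).2 h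
  set d := ip b (lact (σ (rngUnit x)) c) with hd
  have hd0 : 0 < ‖π d‖ := norm_pos_iff.2 hbc
  obtain ⟨a, haA, had⟩ := exists_isA d (ε := ‖π d‖ / 4) (by positivity)
  obtain ⟨g, hgA, hg⟩ := exists_isA_apply_eq_zero_iff haA (e := (‖π d‖ / 2) ^ 2) (by positivity)
  obtain ⟨W, hW, hWy⟩ := exists_nhds_norm_ip_lact_sub_lt hτA.2.1 haA.2.1 (σ := σ) b c
    (ε := ‖π d‖ / 2) (by rw [← hd, norm_sub_rev]; linarith)
  have h1 : Continuous fun q : {q : Ω.G × Ω.toFellBundleData.PrimPair // Ω.src q.1 = q.2.1.1} =>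
    q.1.1 := continuous_fst.comp continuous_subtype_val
  have h2 : Continuous fun q : {q : Ω.G × Ω.toFellBundleData.PrimPair // Ω.src q.1 = q.2.1.1} =>
    q.1.2 := continuous_snd.comp continuous_subtype_val
  have hmem := ((isOpen_hullKernelTop_notMem hgA).preimage h2).mem_nhds
    (x := ⟨⟨x, ⟨⟨Ω.src x, P⟩, hP⟩⟩, rfl⟩) (by
      intro h hgP
      change (g (srcUnit x)).1 ∈ P at hgP
      rw [hPπ] at hgP
      obtain ⟨g', hg', e⟩ := hgP
      rw [Fib.ext e] at hg'
      have h3 := abs_le_of_sq_le_sq' ((hg _ _ π).1 hg') (by positivity)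
      have h4 := NonUnitalStarAlgHom.norm_apply_le π (a (srcUnit x) - d)
      rw [map_sub] at h4
      have h5 := norm_le_norm_add_norm_sub (π (a (srcUnit x))) (π d)
      linarith [h3.2])
  filter_upwards [h1.continuousAt hW, hmem]
  rintro ⟨⟨y, ⟨⟨v, Q⟩, hQ⟩⟩, hy⟩ hyW hgQ hsub
  change Ω.src y = v at hy
  subst hy
  obtain ⟨b', c', hbc'⟩ := hWy y hyW
  obtain ⟨H', _, _, _, ρ, -, -, hQρ⟩ := (mem_primFiber_iff (u := srcUnit y)).1 hQ
  change Q = _ at hQρ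
  refine hgQ (Ω.rng_src y) ?_
  change (g (srcUnit y)).1 ∈ Q
  have h3 : (σ (rngUnit y)).1 ∈ Ω.toFellBundleData.hIdeal y Q :=
    hsub ⟨τ, hτJ, Ω.rng_rng y, rfl⟩
  rw [hQρ] at h3 ⊢
  refine ⟨_, (hg _ _ ρ).2 ?_, rfl⟩
  have h4 := NonUnitalStarAlgHom.norm_apply_le ρ
    (ip b' (lact (σ (rngUnit y)) c') - a (srcUnit y))
  rw [map_sub, (mem_hIdeal_ker_iff ρ).1 h3 b' c', zero_sub, norm_neg] at h4
  exact pow_le_pow_left₀ (norm_nonneg _) (h4.trans hbc'.le) 2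

end FellBundle

/-- If `p : B → G` is a separable Fell bundle over a second
countable locally compact Hausdorff groupoid and `A := Γ₀(G⁰; B)`, then the
`G`-action `x · (s(x), P) := (r(x), h_x(P))` on
`Prim A = {(u, P) : u ∈ G⁰, P ∈ Prim A(u)}` is continuous for the hull-kernel
topology; thus `Prim A` is a topological `G`-space.  (The first conjunct says
that the action is well defined; the second says that the preimage of each
generating open set `O_J = {(u, P) : (u, P) ⊉ J}` (`J` an ideal of `A`) of the
hull-kernel topology under the action map `G * Prim A → Prim A` is open, which
is precisely continuity of the action map.) -/
theorem rieffel_action_continuous (Ω : FellBundle)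
    (hsep : Ω.toFellBundleData.SeparableBundle) :
    (∀ (x : Ω.G) (P : Set Ω.T), P ∈ Ω.toFellBundleData.PrimFiber (Ω.src x) →
      Ω.toFellBundleData.hIdeal x P ∈ Ω.toFellBundleData.PrimFiber (Ω.rng x)) ∧
    (letI : TopologicalSpace Ω.toFellBundleData.PrimPair :=
        Ω.toFellBundleData.hullKernelTop
      ∀ J, Ω.toFellBundleData.IsIdealA J →
        IsOpen {q : {q : Ω.G × Ω.toFellBundleData.PrimPair // Ω.src q.1 = q.2.1.1} |
          ¬ Ω.toFellBundleData.fiberIm J (Ω.rng q.1.1) ⊆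
            Ω.toFellBundleData.hIdeal q.1.1 q.1.2.1.2}) := by
  have := Ω.t2G
  have := Ω.lcG
  exact ⟨fun x P hP => FellBundle.hIdeal_mem_primFiber hP,
    fun J hJ => FellBundle.isOpen_not_fiberIm_subset_hIdeal hJ⟩
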